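/- Let f be a loxodromic automorphism of ℂ². Then there is no saddle periodic point p of f, with unstable parametrization ψ : ℂ → ℂ², such that the frontier in ℂ of ψ⁻¹(K⁺(f)) is equal to a real line through the origin, i.e., to the set {t·v : t ∈ ℝ} for some v ∈ ℂ \ {0}. (In other words, unstably linear loxodromic automorphisms of ℂ² do not exist.) -/

import Mathlib

open Function Set Filter Topology

noncomputable section

/-- A polynomial map of `ℂ²`. -/
def IsPolyMap (F : ℂ × ℂ → ℂ × ℂ) : Prop :=
  ∃ P Q : MvPolynomial (Fin 2) ℂ, ∀ z : ℂ × ℂ,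
    F z = (MvPolynomial.eval ![z.1, z.2] P, MvPolynomial.eval ![z.1, z.2] Q)

/-- A polynomial automorphism of `ℂ²`. -/
def IsPolyAuto (F : ℂ × ℂ → ℂ × ℂ) : Prop :=
  IsPolyMap F ∧ ∃ G : ℂ × ℂ → ℂ × ℂ, IsPolyMap G ∧
    (∀ z, G (F z) = z) ∧ (∀ z, F (G z) = z)

/-- A generalized Hénon map. -/
def IsHenon (h : ℂ × ℂ → ℂ × ℂ) : Prop :=
  ∃ (p : Polynomial ℂ) (a : ℂ), a ≠ 0 ∧ 2 ≤ p.natDegree ∧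
    ∀ z : ℂ × ℂ, h z = (Polynomial.eval z.1 p - a * z.2, z.1)

/-- A loxodromic automorphism of `ℂ²`. -/
def IsLoxodromic (f : ℂ × ℂ → ℂ × ℂ) : Prop :=
  IsPolyAuto f ∧
  ∃ (u uinv : ℂ × ℂ → ℂ × ℂ) (hs : List (ℂ × ℂ → ℂ × ℂ)),
    IsPolyAuto u ∧ (∀ z, uinv (u z) = z) ∧ (∀ z, u (uinv z) = z) ∧
    hs ≠ [] ∧ (∀ h ∈ hs, IsHenon h) ∧
    ∀ z, f z = uinv (hs.foldr (fun h acc => h ∘ acc) id (u z))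

/-- The set of points with bounded forward orbit. -/
def Kplus (f : ℂ × ℂ → ℂ × ℂ) : Set (ℂ × ℂ) :=
  {z | ∃ C : ℝ, ∀ n : ℕ, ‖f^[n] z‖ ≤ C}

/-- `lam` is an eigenvalue of the continuous linear map `T`. -/
def IsEigenvalue (T : (ℂ × ℂ) →L[ℂ] ℂ × ℂ) (lam : ℂ) : Prop :=
  ∃ v : ℂ × ℂ, v ≠ 0 ∧ T v = lam • v

/-- `p` is a saddle periodic point of period `n` with stable multiplier `ls`
and unstable multiplier `lu`. -/
def IsSaddle (f : ℂ × ℂ → ℂ × ℂ) (p : ℂ × ℂ) (n : ℕ) (ls lu : ℂ) : Prop :=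
  1 ≤ n ∧ f^[n] p = p ∧
  IsEigenvalue (fderiv ℂ (f^[n]) p) ls ∧ IsEigenvalue (fderiv ℂ (f^[n]) p) lu ∧
  ‖ls‖ < 1 ∧ 1 < ‖lu‖

/-- Coordinatewise complex conjugation `σ(x,y) = (x̄, ȳ)`. -/
def conjMap (z : ℂ × ℂ) : ℂ × ℂ := (starRingEnd ℂ z.1, starRingEnd ℂ z.2)

/-- The open unit disk in `ℂ`. -/
def unitDisk : Set ℂ := Metric.ball 0 1

/-- `γ` is a transversal to `J⁺`. -/
def IsTransversal (f : ℂ × ℂ → ℂ × ℂ) (γ : ℂ → ℂ × ℂ) : Prop :=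
  Set.InjOn γ unitDisk ∧ DifferentiableOn ℂ γ unitDisk ∧
  (∃ z ∈ unitDisk, γ z ∈ Kplus f) ∧ ¬ (∀ z ∈ unitDisk, γ z ∈ Kplus f)

/-- The Julia slice associated to a transversal. -/
def juliaSlice (f : ℂ × ℂ → ℂ × ℂ) (γ : ℂ → ℂ × ℂ) : Set ℂ :=
  unitDisk ∩ frontier {z | z ∈ unitDisk ∧ γ z ∈ Kplus f}

/-- An unstable parametrization of a saddle periodic point. -/
def IsUnstableParam (f : ℂ × ℂ → ℂ × ℂ) (n : ℕ) (lu : ℂ) (p : ℂ × ℂ) (ψ : ℂ → ℂ × ℂ) : Prop :=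
  Function.Injective ψ ∧ Differentiable ℂ ψ ∧ ψ 0 = p ∧
  ∀ ζ : ℂ, f^[n] (ψ ζ) = ψ (lu * ζ)

/-- `S` is contained in a proper real-analytic subvariety of `ℂ²`. -/
def ContainedInProperRealAnalyticSubvariety (S : Set (ℂ × ℂ)) : Prop :=
  ∃ V : Set (ℂ × ℂ), IsClosed V ∧ V ≠ Set.univ ∧ S ⊆ V ∧
    ∀ x ∈ V, ∃ (U : Set (ℂ × ℂ)) (g : ℂ × ℂ → ℝ),
      IsOpen U ∧ x ∈ U ∧ (∀ y ∈ U, AnalyticAt ℝ g y) ∧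
      (∃ y ∈ U, g y ≠ 0) ∧ ∀ y ∈ V ∩ U, g y = 0


lemma half_plane_rigidity (G : ℂ → ℝ) (lam D : ℝ) (hlam : 1 < lam) (hD : 1 < D)
    (hloc : ∀ ζ : ℂ, 0 < ζ.im → ∃ (F H : ℂ → ℂ) (c : ℝ), AnalyticAt ℂ F ζ ∧ F ζ ≠ 0 ∧
      AnalyticAt ℂ H ζ ∧ G =ᶠ[𝓝 ζ] fun z => c * Real.log ‖F z‖ + (H z).re)
    (hpos : ∀ ζ : ℂ, 0 < ζ.im → 0 < G ζ)
    (hsc : G (lam * Complex.I) = D * G Complex.I) :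
    D ≤ lam ∧ (D = lam → ∃ g : ℝ, 0 < g ∧ ∀ ζ : ℂ, 0 < ζ.im → G ζ = g * ζ.im) := by
  -- Cayley transform
  set C : ℂ → ℂ := fun z => Complex.I * ((1 + z) / (1 - z)) with hC
  have hne : ∀ z ∈ Metric.ball (0:ℂ) 1, 1 - z ≠ 0 := by
    intro z hz h
    have : z = 1 := by linear_combination -h
    rw [this] at hz; simp at hz
  have hCim : ∀ z ∈ Metric.ball (0:ℂ) 1, 0 < (C z).im := by
    intro z hz
    have h1 := hne z hz
    have hn : 0 < Complex.normSq (1 - z) := Complex.normSq_pos.mpr h1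
    have hz' : Complex.normSq z < 1 := by
      rw [Complex.normSq_eq_norm_sq]
      have : ‖z‖ < 1 := by simpa using hz
      nlinarith [norm_nonneg z]
    have : (C z).im = (1 - Complex.normSq z) / Complex.normSq (1 - z) := by
      simp only [hC, Complex.mul_im, Complex.I_re, Complex.I_im, Complex.div_re, Complex.add_re,
        Complex.sub_re, Complex.one_re, Complex.add_im, Complex.sub_im, Complex.one_im]
      rw [← add_div]
      simp [Complex.normSq_apply]
      ring_nf
    rw [this]; exact div_pos (by linarith) hn
  have hCan : ∀ z ∈ Metric.ball (0:ℂ) 1, AnalyticAt ℂ C z := by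
    intro z hz
    have := hne z hz
    refine analyticAt_const.mul (AnalyticAt.div (by fun_prop) (by fun_prop) this)
  have hharm : InnerProductSpace.HarmonicOnNhd (G ∘ C) (Metric.ball 0 1) := by
    intro z hz
    obtain ⟨F, H, c, hF, hF0, hH, hG⟩ := hloc (C z) (hCim z hz)
    have hCz := hCan z hz
    have h1 : InnerProductSpace.HarmonicAt (fun w => Real.log ‖(F ∘ C) w‖) z :=
      AnalyticAt.harmonicAt_log_norm (hF.comp hCz) hF0
    have h2 : InnerProductSpace.HarmonicAt (fun w => ((H ∘ C) w).re) z :=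
      AnalyticAt.harmonicAt_re (hH.comp hCz)
    have h3 := (h1.const_smul (c := c)).add h2
    refine (InnerProductSpace.harmonicAt_congr_nhds ?_).mp h3
    have := hCz.continuousAt.eventually hG
    filter_upwards [this] with w hw
    simp [hw]
  obtain ⟨Θ₀, hΘ₀, hre₀⟩ := hharm.exists_analyticOnNhd_ball_re_eq
  have h00 : (0:ℂ) ∈ Metric.ball (0:ℂ) 1 := by simp
  have hC0 : C 0 = Complex.I := by simp [hC]
  set Θ : ℂ → ℂ := fun z => Θ₀ z - (Θ₀ 0).im * Complex.I with hΘ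
  have hre : ∀ z ∈ Metric.ball (0:ℂ) 1, (Θ z).re = G (C z) := by
    intro z hz
    have := hre₀ hz
    simp [hΘ] ; simpa using this
  set g := G Complex.I with hg
  have hg0 : 0 < g := hpos _ (by simp)
  have hΘ0 : Θ 0 = g := by
    apply Complex.ext
    · rw [hre 0 h00, hC0]; simp [hg]
    · simp [hΘ]
  have hden : ∀ z ∈ Metric.ball (0:ℂ) 1, Θ z + g ≠ 0 := by
    intro z hz h
    have := congrArg Complex.re h
    have h2 := hpos _ (hCim z hz)
    rw [Complex.add_re, hre z hz] at this
    simp at this; linarith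
  set q : ℂ → ℂ := fun z => (Θ z - g) / (Θ z + g) with hq
  have hqd : DifferentiableOn ℂ q (Metric.ball 0 1) := by
    intro z hz
    have hd : DifferentiableAt ℂ Θ z := (hΘ₀ z hz).differentiableAt.sub_const _
    exact ((hd.sub_const _).div (hd.add_const _) (hden z hz)).differentiableWithinAt
  have hq0 : q 0 = 0 := by simp [hq, hΘ0]
  have hqmaps : MapsTo q (Metric.ball 0 1) (Metric.closedBall (q 0) 1) := by
    intro z hz
    rw [hq0, mem_closedBall_zero_iff, hq]
    simp only [norm_div]
    rw [div_le_one (norm_pos_iff.mpr (hden z hz))]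
    have h2 := hpos _ (hCim z hz)
    rw [← hre z hz] at h2
    rw [← sq_le_sq₀ (norm_nonneg _) (norm_nonneg _), ← Complex.normSq_eq_norm_sq,
      ← Complex.normSq_eq_norm_sq]
    simp only [Complex.normSq_apply, Complex.sub_re, Complex.add_re, Complex.sub_im,
      Complex.add_im, Complex.ofReal_re, Complex.ofReal_im]
    nlinarith
  set s : ℝ := (lam - 1) / (lam + 1) with hs
  have hs0 : 0 < s := div_pos (by linarith) (by linarith)
  have hs1 : s < 1 := by rw [hs, div_lt_one (by linarith)]; linarith
  have hsb : (s : ℂ) ∈ Metric.ball (0:ℂ) 1 := by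
    simp [abs_of_pos hs0, hs1]
  have hl1 : (lam : ℂ) + 1 ≠ 0 := by
    have : lam + 1 ≠ 0 := by linarith
    exact_mod_cast this
  have hCs : C s = lam * Complex.I := by
    simp only [hC, hs]
    push_cast
    have : (1 : ℂ) - ((lam:ℂ) - 1) / (lam + 1) ≠ 0 := by
      have e : (1 : ℂ) - ((lam:ℂ) - 1) / (lam + 1) = 2 / (lam + 1) := by field_simp; ring
      rw [e]; exact div_ne_zero two_ne_zero hl1
    field_simp
    ring
  have hΘs : (Θ s).re = D * g := by rw [hre s hsb, hCs, hsc]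
  -- lower bound for |q s|
  set y := (Θ s).im with hy
  have hqs : ‖q s‖ ^ 2 * ((D + 1) ^ 2 * g ^ 2 + y ^ 2) = (D - 1) ^ 2 * g ^ 2 + y ^ 2 := by
    have hn1 : ‖Θ s - g‖ ^ 2 = (D - 1) ^ 2 * g ^ 2 + y ^ 2 := by
      rw [← Complex.normSq_eq_norm_sq]
      simp only [Complex.normSq_apply, Complex.sub_re, Complex.sub_im, Complex.ofReal_re,
        Complex.ofReal_im, hΘs]
      ring
    have hn2 : ‖Θ s + g‖ ^ 2 = (D + 1) ^ 2 * g ^ 2 + y ^ 2 := by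
      rw [← Complex.normSq_eq_norm_sq]
      simp only [Complex.normSq_apply, Complex.add_re, Complex.add_im, Complex.ofReal_re,
        Complex.ofReal_im, hΘs]
      ring
    rw [← hn1, ← hn2, hq]
    simp only [norm_div, div_pow]
    have := norm_pos_iff.mpr (hden s hsb)
    field_simp
  have hqle : ‖q s‖ ≤ s := by
    have := Complex.dist_le_div_mul_dist_of_mapsTo_ball hqd hqmaps hsb
    rw [hq0] at this
    simpa [abs_of_pos hs0] using this
  have hsmul : s * (lam + 1) = lam - 1 := by rw [hs]; field_simp
  have hq2 : ‖q s‖ ^ 2 ≤ s ^ 2 := by gcongr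
  have key : (D - 1) ^ 2 * g ^ 2 + y ^ 2 ≤ s ^ 2 * ((D + 1) ^ 2 * g ^ 2 + y ^ 2) := by
    rw [← hqs]; gcongr
  have hs2 : s ^ 2 < 1 := by nlinarith
  have hkey2 : (1 - s ^ 2) * y ^ 2 ≤ g ^ 2 * (s * (D + 1) - (D - 1)) * (s * (D + 1) + (D - 1)) := by
    nlinarith
  have hDlam : D ≤ lam := by
    by_contra hcon
    push Not at hcon
    have h1 : s * (D + 1) < D - 1 := by
      rw [hs, div_mul_eq_mul_div, div_lt_iff₀ (by linarith)]; nlinarith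
    have h2 : 0 < s * (D + 1) + (D - 1) := by nlinarith
    have h3 : g ^ 2 * (s * (D + 1) - (D - 1)) * (s * (D + 1) + (D - 1)) < 0 := by
      apply mul_neg_of_neg_of_pos _ h2
      apply mul_neg_of_pos_of_neg (by positivity) (by linarith)
    nlinarith [sq_nonneg y, mul_nonneg (by linarith : 0 ≤ 1 - s^2) (sq_nonneg y)]
  refine ⟨hDlam, fun hDl => ⟨g, hg0, ?_⟩⟩
  have hsD : s * (D + 1) - (D - 1) = 0 := by rw [hDl, hsmul]; ring
  have hy0 : y = 0 := by
    rw [hsD] at hkey2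
    have : y ^ 2 ≤ 0 := by nlinarith [sq_nonneg y]
    exact pow_eq_zero_iff two_ne_zero |>.mp (le_antisymm this (sq_nonneg y))
  have hΘs' : Θ s = lam * g := by
    apply Complex.ext
    · simp [hΘs, hDl]
    · simp [← hy, hy0]
  have hqs' : q s = s := by
    simp only [hq]
    rw [hΘs', hs]
    have hgc : (g:ℂ) ≠ 0 := by exact_mod_cast hg0.ne'
    push_cast
    rw [div_eq_div_iff _ hl1]
    · ring
    · rw [← add_one_mul]; exact mul_ne_zero hl1 hgc
  have hsc0 : (s:ℂ) ≠ 0 := by exact_mod_cast hs0.ne'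
  have hds : dslope q 0 s = 1 := by
    rw [dslope_of_ne _ hsc0, slope_def_field, hqs', hq0]
    simp [hsc0]
  have haff := Complex.affine_of_mapsTo_ball_of_norm_dslope_eq_div hqd hqmaps hsb
    (by rw [hds]; simp)
  intro ζ hζ
  have hζI : ζ + Complex.I ≠ 0 := by
    intro h
    have := congrArg Complex.im h
    simp at this; linarith
  set z := (ζ - Complex.I) / (ζ + Complex.I) with hz
  have hzb : z ∈ Metric.ball (0:ℂ) 1 := by
    rw [mem_ball_zero_iff, hz, norm_div, div_lt_one (norm_pos_iff.mpr hζI)]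
    rw [← sq_lt_sq₀ (norm_nonneg _) (norm_nonneg _), ← Complex.normSq_eq_norm_sq,
      ← Complex.normSq_eq_norm_sq]
    simp only [Complex.normSq_apply, Complex.sub_re, Complex.add_re, Complex.sub_im,
      Complex.add_im, Complex.I_re, Complex.I_im]
    nlinarith
  have hCz : C z = ζ := by
    have h1 := hne z hzb
    simp only [hC]
    have e1 : 1 + z = 2 * ζ / (ζ + Complex.I) := by rw [hz]; field_simp; ring
    have e2 : 1 - z = 2 * Complex.I / (ζ + Complex.I) := by rw [hz]; field_simp; ring
    rw [e1, e2]
    field_simp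
  have hqz : q z = z := by
    have := haff hzb
    simpa [hq0, hds] using this
  have hΘz : Θ z = - g * Complex.I * ζ := by
    have h1 := hden z hzb
    have h2 : Θ z - g = z * (Θ z + g) := by
      rw [← div_eq_iff h1]; exact hqz
    have h3 : z * (ζ + Complex.I) = ζ - Complex.I := by rw [hz]; field_simp
    have h4 : (Θ z - g) * (ζ + Complex.I) = (ζ - Complex.I) * (Θ z + g) := by
      rw [h2, ← h3]; ring
    have h5 : 2 * Complex.I * Θ z = 2 * Complex.I * (- g * Complex.I * ζ) := by
      linear_combination h4 + 2 * g * ζ * (Complex.I_sq)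
    exact mul_left_cancel₀ (by simp) h5
  rw [← hCz, ← hre z hzb, hCz, hΘz]
  simp


/-- Escape data for a sequence of entire functions. -/
structure Esc (K : ℕ) (lam : ℝ) (d : ℕ → ℕ) (α : ℕ → ℂ) (X : ℕ → ℂ → ℂ) (R R' C L : ℝ) : Prop where
  hK : 1 ≤ K
  hlam : 1 < lam
  hd : ∀ i, 2 ≤ d i
  hdper : ∀ i, d (i + K) = d i
  hα : ∀ i, α i ≠ 0
  hαper : ∀ i, α (i + K) = α i
  hX : ∀ i, Differentiable ℂ (X i)
  hsc : ∀ i ζ, X (i + K) ζ = X i (lam * ζ)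
  hR1 : 1 ≤ R
  hRR' : R ≤ R'
  hC0 : 0 ≤ C
  hCR : 2 * C ≤ R
  hL : ∀ i, ‖Complex.log (α i)‖ + 1 ≤ L
  hLR : L < Real.log R
  F1 : ∀ i ζ, R ≤ ‖X i ζ‖ → 2 * ‖X i ζ‖ ≤ ‖X (i + 1) ζ‖
  F2 : ∀ i ζ, R ≤ ‖X i ζ‖ → ‖X (i + 1) ζ / (α i * X i ζ ^ d i) - 1‖ ≤ C / ‖X i ζ‖
  F3 : ∀ i ζ, ‖X i ζ‖ ≤ R → ‖X (i + 1) ζ‖ ≤ R'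

/-- Product of the degrees. -/
def wt (d : ℕ → ℕ) (j : ℕ) : ℝ := ∏ i ∈ Finset.range j, (d i : ℝ)

/-- logarithmic increment -/
def ell (d : ℕ → ℕ) (α : ℕ → ℂ) (X : ℕ → ℂ → ℂ) (i : ℕ) (ζ : ℂ) : ℂ :=
  Complex.log (α i) + Complex.log (X (i + 1) ζ / (α i * X i ζ ^ d i))

/-- sum of the increments -/
def BB (d : ℕ → ℕ) (α : ℕ → ℂ) (X : ℕ → ℂ → ℂ) (j : ℕ) (ζ : ℂ) : ℂ :=
  ∑' i : ℕ, ell d α X (j + i) ζ / (wt d (j + i + 1) : ℂ)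

/-- the Green function, computed at level `j` -/
def Gj (d : ℕ → ℕ) (α : ℕ → ℂ) (X : ℕ → ℂ → ℂ) (j : ℕ) (ζ : ℂ) : ℝ :=
  Real.log ‖X j ζ‖ / wt d j + (BB d α X j ζ).re

open Classical in
/-- the Green function -/
def GG (d : ℕ → ℕ) (α : ℕ → ℂ) (X : ℕ → ℂ → ℂ) (R : ℝ) (ζ : ℂ) : ℝ :=
  if h : ∃ j, R < ‖X j ζ‖ then Gj d α X (Nat.find h) ζ else 0

namespace Esc
variable {K : ℕ} {lam : ℝ} {d : ℕ → ℕ} {α : ℕ → ℂ} {X : ℕ → ℂ → ℂ} {R R' C L : ℝ}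

lemma wt_succ (d : ℕ → ℕ) (j : ℕ) : wt d (j + 1) = wt d j * d j := by
  simp [wt, Finset.prod_range_succ]

lemma wt_pos (E : Esc K lam d α X R R' C L) (j : ℕ) : 0 < wt d j := by
  apply Finset.prod_pos
  intro i _
  have := E.hd i
  exact_mod_cast (by omega : 0 < d i)

lemma wt_add (E : Esc K lam d α X R R' C L) (j i : ℕ) : 2 ^ i * wt d j ≤ wt d (j + i) := by
  induction i with
  | zero => simp
  | succ i ih =>
    rw [← add_assoc, wt_succ]
    have h2 : (2:ℝ) ≤ d (j + i) := by exact_mod_cast E.hd (j + i)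
    have := E.wt_pos (j + i)
    rw [pow_succ]
    nlinarith

lemma one_le_wt (E : Esc K lam d α X R R' C L) (j : ℕ) : 1 ≤ wt d j := by
  have := E.wt_add 0 j
  have h0 : wt d 0 = 1 := by simp [wt]
  rw [h0] at this
  have h1 : (1:ℝ) ≤ 2 ^ j := one_le_pow₀ (by norm_num)
  simp at this
  linarith

lemma one_lt_D (E : Esc K lam d α X R R' C L) : 1 < wt d K := by
  have := E.wt_add 0 K
  have h0 : wt d 0 = 1 := by simp [wt]
  rw [h0] at this
  have h1 : (1:ℝ) < 2 ^ K := one_lt_pow₀ (by norm_num) (by have := E.hK; omega)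
  simp at this
  linarith

lemma wt_K (E : Esc K lam d α X R R' C L) (j : ℕ) : wt d (j + K) = wt d K * wt d j := by
  induction j with
  | zero => simp [wt]
  | succ j ih =>
    rw [show j + 1 + K = j + K + 1 by ring, wt_succ, wt_succ, ih, E.hdper]; ring

lemma mono (E : Esc K lam d α X R R' C L) {j : ℕ} {ζ : ℂ} (h : R ≤ ‖X j ζ‖) (i : ℕ) :
    ‖X j ζ‖ ≤ ‖X (j + i) ζ‖ := by
  induction i with
  | zero => simp
  | succ i ih =>
    have := E.F1 (j + i) ζ (h.trans ih)
    have h2 := norm_nonneg (X (j + i) ζ)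
    rw [← add_assoc]
    linarith

lemma mono_lt (E : Esc K lam d α X R R' C L) {j k : ℕ} {ζ : ℂ} (h : R < ‖X j ζ‖) (hjk : j ≤ k) :
    R < ‖X k ζ‖ := by
  obtain ⟨i, rfl⟩ := Nat.exists_eq_add_of_le hjk
  exact h.trans_le (E.mono h.le i)

lemma ne0 (E : Esc K lam d α X R R' C L) {j : ℕ} {ζ : ℂ} (h : R ≤ ‖X j ζ‖) : X j ζ ≠ 0 := by
  intro h0
  rw [h0, norm_zero] at h
  linarith [E.hR1]

lemma eps_half (E : Esc K lam d α X R R' C L) {j : ℕ} {ζ : ℂ} (h : R ≤ ‖X j ζ‖) :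
    ‖X (j + 1) ζ / (α j * X j ζ ^ d j) - 1‖ ≤ 1 / 2 := by
  refine (E.F2 j ζ h).trans ?_
  have : 0 < ‖X j ζ‖ := by linarith [E.hR1]
  rw [div_le_iff₀ this]
  linarith [E.hCR]

lemma log_ratio (E : Esc K lam d α X R R' C L) {j : ℕ} {ζ : ℂ} (h : R ≤ ‖X j ζ‖) :
    ‖Complex.log (X (j + 1) ζ / (α j * X j ζ ^ d j))‖ ≤ 3 / 2 * (C / ‖X j ζ‖) := by
  have h1 := Complex.norm_log_one_add_half_le_self (E.eps_half h)
  rw [add_sub_cancel] at h1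
  have := E.F2 j ζ h
  linarith

lemma ell_bound (E : Esc K lam d α X R R' C L) {j : ℕ} {ζ : ℂ} (h : R ≤ ‖X j ζ‖) :
    ‖ell d α X j ζ‖ ≤ L := by
  have h1 := Complex.norm_log_one_add_half_le_self (E.eps_half h)
  rw [add_sub_cancel] at h1
  have h2 := E.eps_half h
  have h3 := E.hL j
  unfold ell
  refine (norm_add_le _ _).trans ?_
  linarith

lemma L_nonneg (E : Esc K lam d α X R R' C L) : 0 ≤ L := by
  have := E.hL 0
  have := norm_nonneg (Complex.log (α 0))
  linarith

lemma wt_norm (E : Esc K lam d α X R R' C L) (j : ℕ) : ‖(wt d j : ℂ)‖ = wt d j := by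
  rw [Complex.norm_real, Real.norm_of_nonneg (E.wt_pos j).le]

/-- general bound on weighted terms -/
lemma term_bound_gen (E : Esc K lam d α X R R' C L) (j i : ℕ) {x : ℂ} {M : ℝ} (hM : 0 ≤ M)
    (hx : ‖x‖ ≤ M) :
    ‖x / (wt d (j + i + 1) : ℂ)‖ ≤ M / wt d j / 2 / 2 ^ i := by
  rw [norm_div, E.wt_norm]
  have h1 := E.wt_add j (i + 1)
  have h2 := E.wt_pos j
  rw [← add_assoc] at h1
  rw [div_div, div_div]
  have h3 : wt d j * (2 * 2 ^ i) = 2 ^ (i + 1) * wt d j := by rw [pow_succ]; ring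
  rw [h3]
  gcongr

lemma term_bound (E : Esc K lam d α X R R' C L) {j : ℕ} {ζ : ℂ} (h : R ≤ ‖X j ζ‖) (i : ℕ) :
    ‖ell d α X (j + i) ζ / (wt d (j + i + 1) : ℂ)‖ ≤ L / wt d j / 2 / 2 ^ i :=
  E.term_bound_gen j i E.L_nonneg (E.ell_bound (h.trans (E.mono h i)))

lemma summable_term (E : Esc K lam d α X R R' C L) {j : ℕ} {ζ : ℂ} (h : R ≤ ‖X j ζ‖) :
    Summable fun i : ℕ => ell d α X (j + i) ζ / (wt d (j + i + 1) : ℂ) :=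
  Summable.of_norm_bounded (summable_geometric_two' _) (E.term_bound h)

lemma BB_bound (E : Esc K lam d α X R R' C L) {j : ℕ} {ζ : ℂ} (h : R ≤ ‖X j ζ‖) :
    ‖BB d α X j ζ‖ ≤ L / wt d j :=
  tsum_of_norm_bounded (hasSum_geometric_two' _) (E.term_bound h)

lemma BB_succ (E : Esc K lam d α X R R' C L) {j : ℕ} {ζ : ℂ} (h : R ≤ ‖X j ζ‖) :
    BB d α X j ζ = ell d α X j ζ / (wt d (j + 1) : ℂ) + BB d α X (j + 1) ζ := by
  unfold BB
  rw [(E.summable_term h).tsum_eq_zero_add]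
  simp only [add_zero]
  congr 1
  apply tsum_congr
  intro i
  rw [show j + (i + 1) = j + 1 + i by ring]

lemma BB_scale (E : Esc K lam d α X R R' C L) (j : ℕ) (ζ : ℂ) :
    BB d α X j (lam * ζ) = wt d K * BB d α X (j + K) ζ := by
  unfold BB
  rw [← tsum_mul_left]
  apply tsum_congr
  intro i
  have h1 : ell d α X (j + K + i) ζ = ell d α X (j + i) (lam * ζ) := by
    unfold ell
    rw [show j + K + i + 1 = j + i + 1 + K by ring, show j + K + i = j + i + K by ring,
      E.hsc, E.hsc, E.hαper, E.hdper]
  have h2 : wt d (j + K + i + 1) = wt d K * wt d (j + i + 1) := by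
    rw [show j + K + i + 1 = j + i + 1 + K by ring, E.wt_K]
  rw [h1, h2]
  have h3 : (wt d K : ℂ) ≠ 0 := by exact_mod_cast (E.wt_pos K).ne'
  have h4 : (wt d (j + i + 1) : ℂ) ≠ 0 := by exact_mod_cast (E.wt_pos _).ne'
  push_cast
  field_simp

lemma BB_diff (E : Esc K lam d α X R R' C L) (j : ℕ) :
    DifferentiableOn ℂ (BB d α X j) {ζ | R < ‖X j ζ‖} := by
  have ho : IsOpen {ζ | R < ‖X j ζ‖} :=
    isOpen_lt continuous_const (E.hX j).continuous.norm
  apply Complex.differentiableOn_tsum_of_summable_norm (summable_geometric_two' (L / wt d j))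
    _ ho
  · intro i ζ hζ
    exact E.term_bound (le_of_lt hζ) i
  · intro i ζ hζ
    have h := (le_of_lt hζ : R ≤ ‖X j ζ‖)
    have h' : R ≤ ‖X (j + i) ζ‖ := h.trans (E.mono h i)
    apply DifferentiableAt.differentiableWithinAt
    apply DifferentiableAt.div_const
    unfold ell
    apply DifferentiableAt.const_add
    apply DifferentiableAt.clog
    · exact ((E.hX _) ζ).div (((E.hX _) ζ).pow _ |>.const_mul _)
        (mul_ne_zero (E.hα _) (pow_ne_zero _ (E.ne0 h')))
    · have h5 := E.eps_half h'
      have := Complex.mem_slitPlane_of_norm_lt_one (z := X (j + i + 1) ζ / (α (j+i) * X (j+i) ζ ^ d (j+i)) - 1) (by linarith)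
      rwa [add_sub_cancel] at this

lemma Gj_succ (E : Esc K lam d α X R R' C L) {j : ℕ} {ζ : ℂ} (h : R ≤ ‖X j ζ‖) :
    Gj d α X (j + 1) ζ = Gj d α X j ζ := by
  unfold Gj
  rw [E.BB_succ h]
  have hne := E.ne0 h
  have hne1 : X (j + 1) ζ ≠ 0 := E.ne0 (h.trans (E.mono h 1))
  have hre : (ell d α X j ζ).re = Real.log ‖X (j + 1) ζ‖ - d j * Real.log ‖X j ζ‖ := by
    unfold ell
    rw [Complex.add_re, Complex.log_re, Complex.log_re, norm_div, norm_mul, norm_pow,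
      Real.log_div (norm_ne_zero_iff.mpr hne1)
        (mul_ne_zero (norm_ne_zero_iff.mpr (E.hα j)) (pow_ne_zero _ (norm_ne_zero_iff.mpr hne))),
      Real.log_mul (norm_ne_zero_iff.mpr (E.hα j)) (pow_ne_zero _ (norm_ne_zero_iff.mpr hne)),
      Real.log_pow]
    ring
  rw [Complex.add_re, Complex.div_ofReal_re, hre, wt_succ]
  have h1 := (E.wt_pos j).ne'
  have h2 : (d j : ℝ) ≠ 0 := by
    have := E.hd j
    exact_mod_cast (by omega : d j ≠ 0)
  field_simp
  ring

lemma Gj_add (E : Esc K lam d α X R R' C L) {j : ℕ} {ζ : ℂ} (h : R ≤ ‖X j ζ‖) (i : ℕ) :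
    Gj d α X (j + i) ζ = Gj d α X j ζ := by
  induction i with
  | zero => rfl
  | succ i ih => rw [← add_assoc, E.Gj_succ (h.trans (E.mono h i)), ih]

lemma GG_eq (E : Esc K lam d α X R R' C L) {j : ℕ} {ζ : ℂ} (h : R < ‖X j ζ‖) :
    GG d α X R ζ = Gj d α X j ζ := by
  classical
  have hex : ∃ j, R < ‖X j ζ‖ := ⟨j, h⟩
  unfold GG
  rw [dif_pos hex]
  have h1 := Nat.find_spec hex
  have h2 : Nat.find hex ≤ j := Nat.find_le h
  obtain ⟨i, hi⟩ := Nat.exists_eq_add_of_le h2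
  have h3 := E.Gj_add h1.le i
  rw [← hi] at h3
  convert h3.symm

lemma GG_scale (E : Esc K lam d α X R R' C L) {ζ : ℂ} (h : ∃ j, R < ‖X j ζ‖) :
    GG d α X R (lam * ζ) = wt d K * GG d α X R ζ := by
  obtain ⟨j, hj⟩ := h
  have h1 : R < ‖X (j + K) ζ‖ := E.mono_lt hj (by omega)
  have h2 := h1
  rw [E.hsc] at h2
  rw [E.GG_eq h1, E.GG_eq h2]
  unfold Gj
  rw [E.BB_scale, E.hsc, E.wt_K, Complex.re_ofReal_mul]
  have := (E.wt_pos K).ne'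
  have := (E.wt_pos j).ne'
  field_simp

lemma GG_near (E : Esc K lam d α X R R' C L) {j : ℕ} {ζ : ℂ} (h : R < ‖X j ζ‖) :
    |wt d j * GG d α X R ζ - Real.log ‖X j ζ‖| ≤ L := by
  rw [E.GG_eq h]
  unfold Gj
  have hw := E.wt_pos j
  have h1 := E.BB_bound h.le
  have h2 := (Complex.abs_re_le_norm (BB d α X j ζ)).trans h1
  rw [mul_add, mul_div_cancel₀ _ hw.ne', add_sub_cancel_left, abs_mul, abs_of_pos hw]
  rw [le_div_iff₀ hw] at h2
  linarith

lemma GG_pos (E : Esc K lam d α X R R' C L) {ζ : ℂ} (h : ∃ j, R < ‖X j ζ‖) :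
    0 < GG d α X R ζ := by
  obtain ⟨j, hj⟩ := h
  have h1 := abs_le.mp (E.GG_near hj)
  have hw := E.wt_pos j
  have h2 : Real.log R ≤ Real.log ‖X j ζ‖ :=
    Real.log_le_log (by linarith [E.hR1]) hj.le
  have h3 := E.hLR
  have : 0 < wt d j * GG d α X R ζ := by linarith
  exact (mul_pos_iff_of_pos_left hw).mp this

lemma GG_le (E : Esc K lam d α X R R' C L) {ζ : ℂ} (h : ∃ j, R < ‖X j ζ‖) (j : ℕ) :
    GG d α X R ζ ≤ Real.log (max R' ‖X j ζ‖) + L := by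
  classical
  have aux : ∀ i, R < ‖X i ζ‖ → ‖X i ζ‖ ≤ max R' ‖X j ζ‖ →
      GG d α X R ζ ≤ Real.log (max R' ‖X j ζ‖) + L := by
    intro i hi hi2
    have h1 := abs_le.mp (E.GG_near hi)
    have h2 : Real.log ‖X i ζ‖ ≤ Real.log (max R' ‖X j ζ‖) :=
      Real.log_le_log (by linarith [E.hR1]) hi2
    have h3 := E.one_le_wt i
    have h4 := E.GG_pos ⟨i, hi⟩
    nlinarith
  by_cases hj : R < ‖X j ζ‖
  · exact aux j hj (le_max_right _ _)
  · have h1 := Nat.find_spec h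
    have hlt : j < Nat.find h := by
      by_contra hcon
      exact hj (E.mono_lt h1 (by omega))
    obtain ⟨m, hm⟩ : ∃ m, Nat.find h = m + 1 := ⟨Nat.find h - 1, by omega⟩
    have h2 : ¬ R < ‖X m ζ‖ := Nat.find_min h (by omega)
    have h3 := E.F3 m ζ (not_lt.mp h2)
    rw [hm] at h1
    exact aux (m + 1) h1 (h3.trans (le_max_left _ _))

lemma X_le (E : Esc K lam d α X R R' C L) {ζ : ℂ} (h : ∃ j, R < ‖X j ζ‖) (j : ℕ) :
    ‖X j ζ‖ ≤ R * Real.exp (wt d j * GG d α X R ζ + L) := by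
  have hG := E.GG_pos h
  have hw := E.wt_pos j
  have hL := E.L_nonneg
  have hR := E.hR1
  by_cases hj : R < ‖X j ζ‖
  · have h1 := abs_le.mp (E.GG_near hj)
    have h2 : Real.log ‖X j ζ‖ ≤ wt d j * GG d α X R ζ + L := by linarith
    rw [Real.log_le_iff_le_exp (by linarith)] at h2
    have := Real.exp_pos (wt d j * GG d α X R ζ + L)
    nlinarith
  · have : 1 ≤ Real.exp (wt d j * GG d α X R ζ + L) := Real.one_le_exp (by positivity)
    nlinarith [not_lt.mp hj]

lemma GG_loc (E : Esc K lam d α X R R' C L) {ζ : ℂ} (h : ∃ j, R < ‖X j ζ‖) :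
    ∃ (F H : ℂ → ℂ) (c : ℝ), AnalyticAt ℂ F ζ ∧ F ζ ≠ 0 ∧
      AnalyticAt ℂ H ζ ∧ GG d α X R =ᶠ[𝓝 ζ] fun z => c * Real.log ‖F z‖ + (H z).re := by
  obtain ⟨j, hj⟩ := h
  have ho : IsOpen {ζ | R < ‖X j ζ‖} :=
    isOpen_lt continuous_const (E.hX j).continuous.norm
  refine ⟨X j, BB d α X j, (wt d j)⁻¹, (E.hX j).analyticAt ζ, E.ne0 hj.le,
    (E.BB_diff j).analyticAt (ho.mem_nhds hj), ?_⟩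
  filter_upwards [ho.mem_nhds hj] with z hz
  rw [E.GG_eq hz, Gj]
  ring

end Esc

namespace Esc
variable {K : ℕ} {lam : ℝ} {d : ℕ → ℕ} {α : ℕ → ℂ} {X : ℕ → ℂ → ℂ} {R R' C L : ℝ}

lemma GG_scale_pow (E : Esc K lam d α X R R' C L)
    (hU : ∀ ζ : ℂ, 0 < ζ.im → ∃ j, R < ‖X j ζ‖) (m : ℕ) {ζ : ℂ} (hζ : 0 < ζ.im) :
    GG d α X R ((lam : ℂ) ^ m * ζ) = wt d K ^ m * GG d α X R ζ := by
  have hl : 0 < lam := by linarith [E.hlam]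
  induction m with
  | zero => simp
  | succ m ih =>
    have h1 : 0 < ((lam : ℂ) ^ m * ζ).im := by
      rw [← Complex.ofReal_pow, Complex.im_ofReal_mul]; positivity
    rw [pow_succ', mul_assoc, E.GG_scale (hU _ h1), ih]; ring

lemma not_D_lt (E : Esc K lam d α X R R' C L)
    (hU : ∀ ζ : ℂ, 0 < ζ.im → ∃ j, R < ‖X j ζ‖)
    (hreal : ∀ (t : ℝ) j, ‖X j t‖ ≤ R) : ¬ wt d K < lam := by
  intro hlt
  have hD := E.one_lt_D
  have hl := E.hlam
  have hl0 : 0 < lam := by linarith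
  have hD0 : 0 < wt d K := by linarith
  obtain ⟨M₀, hM₀⟩ := (isCompact_closedBall (0:ℂ) 1).exists_bound_of_continuousOn
    (E.hX 0).continuous.continuousOn
  set M : ℝ := |Real.log (max R' M₀) + L| with hM
  have hGM : ∀ ζ : ℂ, 0 < ζ.im → ‖ζ‖ ≤ 1 → GG d α X R ζ ≤ M := by
    intro ζ hζ h1
    refine (E.GG_le (hU ζ hζ) 0).trans (le_trans ?_ (le_abs_self _))
    have h2 := hM₀ ζ (by simpa using h1)
    have h3 : 0 < max R' ‖X 0 ζ‖ := lt_max_of_lt_left (by linarith [E.hR1, E.hRR'])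
    have := Real.log_le_log h3 (max_le_max_left R' h2)
    linarith
  set ρ : ℝ := Real.log (wt d K) / Real.log lam with hρ
  have hlogl : 0 < Real.log lam := Real.log_pos hl
  have hlogD : 0 < Real.log (wt d K) := Real.log_pos hD
  have hρ0 : 0 < ρ := div_pos hlogD hlogl
  have hρ1 : ρ < 1 := by
    rw [hρ, div_lt_one hlogl]; exact Real.log_lt_log hD0 hlt
  have hDρ : wt d K = lam ^ ρ := by
    rw [Real.rpow_def_of_pos hl0, hρ, mul_div_cancel₀ _ hlogl.ne', Real.exp_log hD0]
  have hgrow : ∀ ζ : ℂ, 0 < ζ.im → 1 ≤ ‖ζ‖ → GG d α X R ζ ≤ M * wt d K * ‖ζ‖ ^ ρ := by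
    intro ζ hζ h1
    obtain ⟨n, hn1, hn2⟩ := exists_nat_pow_near h1 hl
    have hp : 0 < lam ^ (n + 1) := by positivity
    set ξ : ℂ := ((lam ^ (n + 1))⁻¹ : ℝ) * ζ with hξ
    have hξim : 0 < ξ.im := by rw [hξ, Complex.im_ofReal_mul]; positivity
    have hξn : ‖ξ‖ ≤ 1 := by
      rw [hξ, norm_mul, Complex.norm_real, Real.norm_of_nonneg (by positivity), inv_mul_le_iff₀ hp]
      linarith
    have hζξ : ζ = (lam : ℂ) ^ (n + 1) * ξ := by
      rw [hξ]; push_cast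
      have : (lam : ℂ) ≠ 0 := by exact_mod_cast hl0.ne'
      field_simp
    have h2 := E.GG_scale_pow hU (n + 1) hξim
    rw [← hζξ] at h2
    rw [h2]
    have h3 := hGM ξ hξim hξn
    have h4 : wt d K ^ n ≤ ‖ζ‖ ^ ρ := by
      calc wt d K ^ n = (lam ^ n) ^ ρ := by
            conv_lhs => rw [hDρ]
            rw [← Real.rpow_natCast, ← Real.rpow_natCast, ← Real.rpow_mul hl0.le,
              ← Real.rpow_mul hl0.le, mul_comm]
        _ ≤ ‖ζ‖ ^ ρ := Real.rpow_le_rpow (by positivity) hn1 hρ0.le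
    have hM0 : 0 ≤ M := abs_nonneg _
    calc wt d K ^ (n + 1) * GG d α X R ξ ≤ wt d K ^ (n + 1) * M := by gcongr
      _ = M * wt d K * wt d K ^ n := by ring
      _ ≤ M * wt d K * ‖ζ‖ ^ ρ := by gcongr
  obtain ⟨j, hj⟩ := hU (2 * Complex.I) (by simp)
  have hPL : ‖X j ((1 + Complex.I) ^ 2)‖ ≤ R := by
    have := PhragmenLindelof.quadrant_I (f := fun z => X j (z ^ 2)) (C := R)
      (z := 1 + Complex.I) ?_ ?_ ?_ ?_ (by simp) (by simp)
    · exact this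
    · exact ((E.hX j).comp (differentiable_id.pow 2)).diffContOnCl
    · refine ⟨2 * ρ, by linarith, wt d j * (M * wt d K), ?_⟩
      apply Asymptotics.IsBigO.of_bound (R * Real.exp L)
      rw [Filter.eventually_inf_principal]
      have hco : ∀ᶠ z : ℂ in Bornology.cobounded ℂ, 1 ≤ ‖z‖ :=
        (tendsto_norm_cobounded_atTop (E := ℂ)).eventually_ge_atTop 1
      filter_upwards [hco] with z hz hzq
      rw [Complex.mem_reProdIm] at hzq
      have him : 0 < (z ^ 2).im := by
        rw [pow_two, Complex.mul_im]
        have h1 : 0 < z.re := hzq.1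
        have h2 : 0 < z.im := hzq.2
        positivity
      have h1 := E.X_le (hU _ him) j
      have h2 := hgrow (z ^ 2) him (by rw [norm_pow]; exact one_le_pow₀ hz)
      rw [norm_pow, ← Real.rpow_natCast, ← Real.rpow_mul (norm_nonneg z)] at h2
      rw [Real.norm_of_nonneg (Real.exp_pos _).le, mul_assoc, ← Real.exp_add]
      refine h1.trans ?_
      have hw := E.wt_pos j
      have hR := E.hR1
      have h3 : wt d j * GG d α X R (z ^ 2) + L
          ≤ L + wt d j * (M * wt d K) * ‖z‖ ^ (2 * ρ) := by
        have := mul_le_mul_of_nonneg_left h2 hw.le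
        push_cast at this
        linarith
      gcongr
    · intro x _
      have := hreal (x ^ 2) j
      push_cast at this
      exact this
    · intro x _
      have := hreal (-x ^ 2) j
      push_cast at this
      rw [mul_pow, Complex.I_sq]
      simpa using this
  have h12 : (1 + Complex.I) ^ 2 = 2 * Complex.I := by
    linear_combination Complex.I_sq
  rw [h12] at hPL
  linarith

lemma asymp (E : Esc K lam d α X R R' C L)
    (hU : ∀ ζ : ℂ, 0 < ζ.im → ∃ j, R < ‖X j ζ‖)
    (hreal : ∀ (t : ℝ) j, ‖X j t‖ ≤ R) :
    ∃ g : ℝ, 0 < g ∧ ∀ j, ∃ β : ℂ, β ≠ 0 ∧ ∃ C' : ℝ, ∀ ζ : ℂ, 0 < ζ.im →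
      ‖X j ζ - β * Complex.exp (-(Complex.I * ((wt d j * g : ℝ) * ζ)))‖ ≤ C' := by
  obtain ⟨h1, h2⟩ := half_plane_rigidity (GG d α X R) lam (wt d K) E.hlam E.one_lt_D
    (fun ζ hζ => E.GG_loc (hU ζ hζ)) (fun ζ hζ => E.GG_pos (hU ζ hζ))
    (E.GG_scale (hU _ (by simp)))
  obtain ⟨g, hg, hG⟩ := h2 (le_antisymm h1 (not_lt.mp (E.not_D_lt hU hreal)))
  refine ⟨g, hg, fun j => ?_⟩
  have hw := E.wt_pos j
  have hR := E.hR1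
  have hRR' := E.hRR'
  have hL := E.L_nonneg
  set w := wt d j with hwdef
  set M : ℝ := (Real.log R' + L) / g with hM
  have hM0 : 0 ≤ M := by
    have : 0 ≤ Real.log R' := Real.log_nonneg (by linarith)
    positivity
  have hbig : ∀ ζ : ℂ, M < ζ.im → R < ‖X j ζ‖ := by
    intro ζ hζ
    by_contra hcon
    push Not at hcon
    have hζ0 : 0 < ζ.im := by linarith
    have h3 := E.GG_le (hU ζ hζ0) j
    rw [max_eq_left (hcon.trans hRR'), hG ζ hζ0] at h3
    rw [hM, div_lt_iff₀ hg] at hζ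
    linarith
  set H : Set ℂ := {ζ | M < ζ.im} with hH
  have hHo : IsOpen H := isOpen_lt continuous_const Complex.continuous_im
  have hHc : IsPreconnected H := (convex_halfSpace_im_gt M).isPreconnected
  set Q : ℂ → ℂ := fun ζ => X j ζ * Complex.exp (w * BB d α X j ζ) *
    Complex.exp (Complex.I * ((w * g : ℝ) * ζ)) with hQ
  have hQn : ∀ ζ ∈ H, ‖Q ζ‖ = 1 := by
    intro ζ hζ
    have hb := hbig ζ hζ
    have h3 := E.GG_eq hb
    rw [hG ζ (by have : M < ζ.im := hζ; linarith), Gj, ← hwdef] at h3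
    rw [hQ]
    simp only [norm_mul, Complex.norm_exp]
    have hx : 0 < ‖X j ζ‖ := by linarith
    rw [← Real.exp_log hx, ← Real.exp_add, ← Real.exp_add, Real.exp_eq_one_iff]
    have e1 : (Complex.I * ((w * g : ℝ) * ζ)).re = - (w * (g * ζ.im)) := by
      rw [Complex.I_mul_re, Complex.im_ofReal_mul]; ring
    rw [e1, h3, Complex.re_ofReal_mul]
    field_simp
    ring
  have hQd : DifferentiableOn ℂ Q H := by
    intro ζ hζ
    have hb := hbig ζ hζ
    have ho : IsOpen {ζ | R < ‖X j ζ‖} :=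
      isOpen_lt continuous_const (E.hX j).continuous.norm
    have h4 : DifferentiableAt ℂ (BB d α X j) ζ :=
      (E.BB_diff j).differentiableAt (ho.mem_nhds hb)
    have h5 := (E.hX j) ζ
    apply DifferentiableAt.differentiableWithinAt
    rw [hQ]
    fun_prop
  set ζ₀ : ℂ := ((M + 1 : ℝ) : ℂ) * Complex.I with hζ₀
  have hζ₀H : ζ₀ ∈ H := by
    change M < ζ₀.im
    rw [hζ₀, Complex.im_ofReal_mul]; simp
  have hmax : IsMaxOn (norm ∘ Q) H ζ₀ := by
    intro ζ hζ
    simp [hQn ζ hζ, hQn ζ₀ hζ₀H]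
  have hconst := Complex.eqOn_of_isPreconnected_of_isMaxOn_norm hHc hHo hQd hζ₀H hmax
  set κ := Q ζ₀ with hκ
  have hκ0 : κ ≠ 0 := by
    intro h0
    have := hQn ζ₀ hζ₀H
    rw [← hκ, h0] at this; simp at this
  set c : ℂ := ∑' i : ℕ, Complex.log (α (j + i)) / (wt d (j + i + 1) : ℂ) with hc
  have hcs : Summable fun i : ℕ => Complex.log (α (j + i)) / (wt d (j + i + 1) : ℂ) := by
    refine Summable.of_norm_bounded (summable_geometric_two' (L / wt d j)) (fun i => ?_)
    exact E.term_bound_gen j i hL (by have := E.hL (j + i); linarith)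
  set β : ℂ := κ * Complex.exp (-(w * c)) with hβ
  refine ⟨β, mul_ne_zero hκ0 (Complex.exp_ne_zero _), ?_⟩
  refine ⟨max (3 * C) (R * Real.exp (w * (g * M) + L) + ‖β‖ * Real.exp (w * g * M)), ?_⟩
  intro ζ hζ
  have hE : ‖Complex.exp (-(Complex.I * ((w * g : ℝ) * ζ)))‖ = Real.exp (w * g * ζ.im) := by
    rw [Complex.norm_exp]
    congr 1
    rw [Complex.neg_re, Complex.I_mul_re, Complex.im_ofReal_mul]; ring
  by_cases hζM : M < ζ.im
  · refine le_trans ?_ (le_max_left _ _)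
    have hb := hbig ζ hζM
    have hb' := hb.le
    have hq : Q ζ = κ := hconst hζM
    set t : ℂ := w * ∑' i : ℕ, Complex.log (X (j + i + 1) ζ / (α (j + i) * X (j + i) ζ ^ d (j + i)))
      / (wt d (j + i + 1) : ℂ) with ht
    have hxp : 0 < ‖X j ζ‖ := by linarith
    have hC := E.hC0
    have hterm : ∀ i : ℕ, ‖Complex.log (X (j + i + 1) ζ / (α (j + i) * X (j + i) ζ ^ d (j + i)))
      / (wt d (j + i + 1) : ℂ)‖ ≤ (3 / 2 * (C / ‖X j ζ‖)) / wt d j / 2 / 2 ^ i := by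
      intro i
      apply E.term_bound_gen j i (by positivity)
      have hm := E.mono hb' i
      refine (E.log_ratio (hb'.trans hm)).trans ?_
      gcongr
    have hts := Summable.of_norm_bounded (summable_geometric_two' _) hterm
    have htn : ‖t‖ ≤ 3 / 2 * (C / ‖X j ζ‖) := by
      have := tsum_of_norm_bounded (hasSum_geometric_two' _) hterm
      rw [ht, norm_mul, hwdef, E.wt_norm]
      rw [le_div_iff₀ (by rw [← hwdef]; exact hw)] at this
      linarith
    have hBB : w * BB d α X j ζ = w * c + t := by
      rw [ht, ← mul_add, hc, ← hcs.tsum_add hts]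
      congr 1
      unfold BB
      apply tsum_congr
      intro i
      rw [ell, add_div]
    have hXt : X j ζ * Complex.exp t = β * Complex.exp (-(Complex.I * ((w * g : ℝ) * ζ))) := by
      rw [hβ, ← hq, hQ]
      simp only
      rw [hBB, Complex.exp_add, Complex.exp_neg, Complex.exp_neg]
      have := Complex.exp_ne_zero (w * c)
      have := Complex.exp_ne_zero (Complex.I * ((w * g : ℝ) * ζ))
      field_simp
    have ht1 : ‖t‖ ≤ 1 := by
      refine htn.trans ?_
      have : C / ‖X j ζ‖ ≤ 1 / 2 := by
        rw [div_le_iff₀ hxp]; linarith [E.hCR]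
      linarith
    rw [← hXt]
    have e : X j ζ - X j ζ * Complex.exp t = - (X j ζ * (Complex.exp t - 1)) := by ring
    rw [e, norm_neg, norm_mul]
    have h6 := Complex.norm_exp_sub_one_le ht1
    have h7 : ‖X j ζ‖ * (3 / 2 * (C / ‖X j ζ‖)) = 3 / 2 * C := by field_simp
    calc ‖X j ζ‖ * ‖Complex.exp t - 1‖ ≤ ‖X j ζ‖ * (2 * (3 / 2 * (C / ‖X j ζ‖))) := by
          gcongr; linarith
      _ = 3 * C := by linear_combination 2 * h7
  · push Not at hζM
    refine le_trans ?_ (le_max_right _ _)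
    refine (norm_sub_le _ _).trans ?_
    have h3 := E.X_le (hU ζ hζ) j
    rw [hG ζ hζ, ← hwdef] at h3
    rw [norm_mul, hE]
    refine add_le_add (h3.trans ?_) ?_ <;> gcongr

end Esc


lemma expo_ne_one {x : ℝ} (h0 : 0 < x) (h1 : x < 1) :
    Complex.exp (Complex.I * ((2 * Real.pi * x : ℝ) : ℂ)) ≠ 1 := by
  intro h
  rw [Complex.exp_eq_one_iff] at h
  obtain ⟨n, hn⟩ := h
  have h2 : ((2 * Real.pi * x : ℝ) : ℂ) = ((n * (2 * Real.pi) : ℝ) : ℂ) := by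
    have := Complex.I_ne_zero
    apply mul_left_cancel₀ this
    rw [hn]; push_cast; ring
  have h3 : 2 * Real.pi * x = n * (2 * Real.pi) := by exact_mod_cast h2
  have h4 : x = n := by
    have := Real.pi_pos
    have h5 : (2 * Real.pi) * x = (2 * Real.pi) * n := by linarith
    exact mul_left_cancel₀ (by positivity) h5
  rw [h4] at h0 h1
  have a1 : (0:ℤ) < n := by exact_mod_cast h0
  have a2 : n < (1:ℤ) := by exact_mod_cast h1
  omega

lemma three_exp {u v c k e1 e2 m : ℂ} (hu : u ≠ 0) (hv : v ≠ 0) (h1 : e1 ≠ 1) (h2 : e2 ≠ 1)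
    (h12 : e1 ≠ e2) (h : ∀ n : ℕ, u * e1 ^ n + v * e2 ^ n + c * m ^ n = k) : False := by
  have a0 := h 0
  have a1 := h 1
  have a2 := h 2
  have a3 := h 3
  have b1 : u * (e1 - 1) * ((e1 - m) * (e1 - e2)) = 0 := by
    linear_combination (a3 - a2) - (e2 + m) * (a2 - a1) + (e2 * m) * (a1 - a0)
  have b2 : v * (e2 - 1) * ((e2 - m) * (e2 - e1)) = 0 := by
    linear_combination (a3 - a2) - (e1 + m) * (a2 - a1) + (e1 * m) * (a1 - a0)
  have h1' := sub_ne_zero.2 h1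
  have h2' := sub_ne_zero.2 h2
  have c1 : e1 - m = 0 := by
    by_contra hc
    exact mul_ne_zero (mul_ne_zero hu h1') (mul_ne_zero hc (sub_ne_zero.2 h12)) b1
  have c2 : e2 - m = 0 := by
    by_contra hc
    exact mul_ne_zero (mul_ne_zero hv h2') (mul_ne_zero hc (sub_ne_zero.2 h12.symm)) b2
  exact h12 (by linear_combination c1 - c2)

namespace Esc
variable {K : ℕ} {lam : ℝ} {d : ℕ → ℕ} {α : ℕ → ℂ} {X : ℕ → ℂ → ℂ} {R R' C L : ℝ}

lemma neg (E : Esc K lam d α X R R' C L) : Esc K lam d α (fun i ζ => X i (-ζ)) R R' C L where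
  hK := E.hK
  hlam := E.hlam
  hd := E.hd
  hdper := E.hdper
  hα := E.hα
  hαper := E.hαper
  hX := fun i => (E.hX i).comp differentiable_neg
  hsc := fun i ζ => by simp only [E.hsc, mul_neg]
  hR1 := E.hR1
  hRR' := E.hRR'
  hC0 := E.hC0
  hCR := E.hCR
  hL := E.hL
  hLR := E.hLR
  F1 := fun i ζ => E.F1 i (-ζ)
  F2 := fun i ζ => E.F2 i (-ζ)
  F3 := fun i ζ => E.F3 i (-ζ)

lemma norm_expo_le {w : ℝ} (hw : 0 ≤ w) {ζ : ℂ} (hζ : ζ.im ≤ 0) :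
    ‖Complex.exp (-(Complex.I * ((w : ℝ) * ζ)))‖ ≤ 1 := by
  rw [Complex.norm_exp, Real.exp_le_one_iff, Complex.neg_re, Complex.I_mul_re,
    Complex.im_ofReal_mul, neg_neg]
  exact mul_nonpos_of_nonneg_of_nonpos hw hζ

lemma repr1 (E : Esc K lam d α X R R' C L)
    (hU : ∀ ζ : ℂ, 0 < ζ.im → ∃ j, R < ‖X j ζ‖) (hlow : ∀ ζ : ℂ, ζ.im ≤ 0 → ∀ j, ‖X j ζ‖ ≤ R) :
    ∃ g : ℝ, 0 < g ∧ ∀ j, ∃ β γ : ℂ, β ≠ 0 ∧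
      ∀ ζ, X j ζ = γ + β * Complex.exp (-(Complex.I * ((wt d j * g : ℝ) * ζ))) := by
  obtain ⟨g, hg, h⟩ := E.asymp hU (fun t j => hlow t (by simp) j)
  refine ⟨g, hg, fun j => ?_⟩
  obtain ⟨β, hβ, C', hC'⟩ := h j
  have hw : 0 < wt d j * g := mul_pos (E.wt_pos j) hg
  set Y : ℂ → ℂ := fun ζ => X j ζ - β * Complex.exp (-(Complex.I * ((wt d j * g : ℝ) * ζ))) with hY
  have hYd : Differentiable ℂ Y := by
    have := E.hX j
    fun_prop
  have hYb : Bornology.IsBounded (range Y) := by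
    rw [isBounded_iff_forall_norm_le]
    refine ⟨max C' (R + ‖β‖), ?_⟩
    rintro _ ⟨ζ, rfl⟩
    rcases lt_or_ge 0 ζ.im with hζ | hζ
    · exact (hC' ζ hζ).trans (le_max_left _ _)
    · refine le_trans ?_ (le_max_right _ _)
      refine (norm_sub_le _ _).trans (add_le_add (hlow ζ hζ j) ?_)
      rw [norm_mul]
      exact mul_le_of_le_one_right (norm_nonneg _) (norm_expo_le hw.le hζ)
  refine ⟨β, Y 0, hβ, fun ζ => ?_⟩
  have := hYd.apply_eq_apply_of_bounded hYb ζ 0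
  rw [← this, hY]; ring

lemma repr2 (E : Esc K lam d α X R R' C L)
    (hU : ∀ ζ : ℂ, 0 < ζ.im → ∃ j, R < ‖X j ζ‖) (hreal : ∀ (t : ℝ) j, ‖X j t‖ ≤ R)
    (hlow : ∀ ζ : ℂ, ζ.im < 0 → ∃ j, R < ‖X j ζ‖) :
    ∃ g g' : ℝ, 0 < g ∧ 0 < g' ∧ ∀ j, ∃ β β' γ : ℂ, β ≠ 0 ∧ β' ≠ 0 ∧
      ∀ ζ, X j ζ = γ + β * Complex.exp (-(Complex.I * ((wt d j * g : ℝ) * ζ)))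
        + β' * Complex.exp (Complex.I * ((wt d j * g' : ℝ) * ζ)) := by
  obtain ⟨g, hg, h⟩ := E.asymp hU hreal
  obtain ⟨g', hg', h'⟩ := E.neg.asymp (fun ζ hζ => hlow (-ζ) (by simpa using hζ))
    (fun t j => by simpa using hreal (-t) j)
  refine ⟨g, g', hg, hg', fun j => ?_⟩
  obtain ⟨β, hβ, C₁, hC₁⟩ := h j
  obtain ⟨β', hβ', C₂, hC₂⟩ := h' j
  have hw : 0 < wt d j * g := mul_pos (E.wt_pos j) hg
  have hw' : 0 < wt d j * g' := mul_pos (E.wt_pos j) hg'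
  have n1 : ∀ ζ : ℂ, ζ.im ≤ 0 →
      ‖β * Complex.exp (-(Complex.I * ((wt d j * g : ℝ) * ζ)))‖ ≤ ‖β‖ := fun ζ hζ => by
    rw [norm_mul]
    exact mul_le_of_le_one_right (norm_nonneg _) (norm_expo_le hw.le hζ)
  have n2 : ∀ ζ : ℂ, 0 ≤ ζ.im →
      ‖β' * Complex.exp (Complex.I * ((wt d j * g' : ℝ) * ζ))‖ ≤ ‖β'‖ := fun ζ hζ => by
    rw [norm_mul]
    have := norm_expo_le hw'.le (ζ := -ζ) (by simpa using hζ)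
    rw [mul_neg, mul_neg, neg_neg] at this
    exact mul_le_of_le_one_right (norm_nonneg _) this
  set Y : ℂ → ℂ := fun ζ => X j ζ - β * Complex.exp (-(Complex.I * ((wt d j * g : ℝ) * ζ)))
    - β' * Complex.exp (Complex.I * ((wt d j * g' : ℝ) * ζ)) with hY
  have hYd : Differentiable ℂ Y := by
    have := E.hX j
    fun_prop
  have hYb : Bornology.IsBounded (range Y) := by
    rw [isBounded_iff_forall_norm_le]
    refine ⟨max (C₁ + ‖β'‖) (max (C₂ + ‖β‖) (R + ‖β‖ + ‖β'‖)), ?_⟩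
    rintro _ ⟨ζ, rfl⟩
    rcases lt_trichotomy 0 ζ.im with hζ | hζ | hζ
    · refine le_trans ?_ (le_max_left _ _)
      exact (norm_sub_le _ _).trans (add_le_add (hC₁ ζ hζ) (n2 ζ hζ.le))
    · refine le_trans ?_ ((le_max_right _ _).trans (le_max_right _ _))
      have hz : ζ = ((ζ.re : ℝ) : ℂ) := by
        apply Complex.ext <;> simp [← hζ]
      refine (norm_sub_le _ _).trans (add_le_add ((norm_sub_le _ _).trans (add_le_add ?_ (n1 ζ hζ.ge))) (n2 ζ hζ.le))
      rw [hz]; exact hreal _ _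
    · refine le_trans ?_ ((le_max_left _ _).trans (le_max_right _ _))
      have h5 := hC₂ (-ζ) (by simpa using hζ)
      simp only [mul_neg, neg_neg] at h5
      have : Y ζ = (X j ζ - β' * Complex.exp (Complex.I * ((wt d j * g' : ℝ) * ζ)))
         - β * Complex.exp (-(Complex.I * ((wt d j * g : ℝ) * ζ))) := by rw [hY]; ring
      rw [this]
      exact (norm_sub_le _ _).trans (add_le_add h5 (n1 ζ hζ.le))
  refine ⟨β, β', Y 0, hβ, hβ', fun ζ => ?_⟩
  have := hYd.apply_eq_apply_of_bounded hYb ζ 0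
  rw [← this, hY]; ring

lemma final1 (E : Esc K lam d α X R R' C L)
    (hU : ∀ ζ : ℂ, 0 < ζ.im → ∃ j, R < ‖X j ζ‖) (hlow : ∀ ζ : ℂ, ζ.im ≤ 0 → ∀ j, ‖X j ζ‖ ≤ R)
    (p : Polynomial ℂ) (a : ℂ) (ha : a ≠ 0)
    (hrec : ∀ ζ, X 2 ζ = p.eval (X 1 ζ) - a * X 0 ζ) : False := by
  obtain ⟨g, hg, h⟩ := E.repr1 hU hlow
  obtain ⟨β0, γ0, hβ0, h0⟩ := h 0
  obtain ⟨β1, γ1, hβ1, h1⟩ := h 1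
  obtain ⟨β2, γ2, hβ2, h2⟩ := h 2
  have w0 : wt d 0 = 1 := by simp [wt]
  have w1 : wt d 1 = d 0 := by rw [wt_succ, w0, one_mul]
  have w2 : wt d 2 = d 0 * d 1 := by rw [wt_succ, w1]
  have d0 : (2:ℝ) ≤ d 0 := by exact_mod_cast E.hd 0
  have dp : (0:ℝ) < d 0 := by linarith
  set T : ℝ := -(2 * Real.pi / (d 0 * g)) with hT
  have key : ∀ w : ℝ, -(Complex.I * ((w : ℝ) * (T:ℂ))) = Complex.I * ((2 * Real.pi * (w / (d 0 * g)) : ℝ) : ℂ) := by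
    intro w
    rw [hT]; push_cast; ring
  have e1 : X 1 T = X 1 0 := by
    rw [h1, h1, key, w1, div_self (by positivity)]
    have : Complex.exp (Complex.I * ((2 * Real.pi * 1 : ℝ):ℂ)) = 1 := by
      rw [Complex.exp_eq_one_iff]; refine ⟨1, ?_⟩; push_cast; ring
    rw [this]; simp
  have e2 : X 2 T = X 2 0 := by
    have : (d 0 * d 1 * g : ℝ) / (d 0 * g) = d 1 := by field_simp
    rw [h2, h2, key, w2, this]
    have : Complex.exp (Complex.I * ((2 * Real.pi * (d 1) : ℝ):ℂ)) = 1 := by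
      rw [Complex.exp_eq_one_iff]; refine ⟨d 1, ?_⟩; push_cast; ring
    rw [this]; simp
  have e0 : X 0 T = X 0 0 := by
    have r1 := hrec T
    have r2 := hrec 0
    rw [e1, e2] at r1
    exact mul_left_cancel₀ ha (by linear_combination r1 - r2)
  rw [h0, h0, key, w0] at e0
  have : (1 * g / (d 0 * g) : ℝ) = 1 / d 0 := by field_simp
  rw [this] at e0
  have hne := expo_ne_one (x := 1 / d 0) (by positivity) (by rw [div_lt_one dp]; linarith)
  apply hne
  have e3 := add_left_cancel e0
  have e4 := mul_left_cancel₀ hβ0 e3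
  rw [e4]; simp

lemma final2 (E : Esc K lam d α X R R' C L)
    (hU : ∀ ζ : ℂ, 0 < ζ.im → ∃ j, R < ‖X j ζ‖) (hreal : ∀ (t : ℝ) j, ‖X j t‖ ≤ R)
    (hlow : ∀ ζ : ℂ, ζ.im < 0 → ∃ j, R < ‖X j ζ‖)
    (p : Polynomial ℂ) (a : ℂ) (ha : a ≠ 0)
    (hrec : ∀ ζ, X 2 ζ = p.eval (X 1 ζ) - a * X 0 ζ) : False := by
  obtain ⟨g, g', hg, hg', h⟩ := E.repr2 hU hreal hlow
  obtain ⟨β0, β0', γ0, hβ0, hβ0', h0⟩ := h 0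
  obtain ⟨β1, β1', γ1, hβ1, hβ1', h1⟩ := h 1
  obtain ⟨β2, β2', γ2, hβ2, hβ2', h2⟩ := h 2
  have w0 : wt d 0 = 1 := by simp [wt]
  have w1 : wt d 1 = d 0 := by rw [wt_succ, w0, one_mul]
  have w2 : wt d 2 = d 0 * d 1 := by rw [wt_succ, w1]
  have d0 : (2:ℝ) ≤ d 0 := by exact_mod_cast E.hd 0
  have dp : (0:ℝ) < d 0 := by linarith
  rw [w0] at h0
  rw [w1] at h1
  rw [w2] at h2
  set q : ℝ := d 0 * (g + g') with hq
  have qp : 0 < q := by positivity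
  set T : ℝ := 2 * Real.pi / q with hT
  -- the base point
  obtain ⟨ζ₀, hζ₀⟩ : ∃ ζ₀ : ℂ, β1 * Complex.exp (-(Complex.I * ((d 0 * g : ℝ) * ζ₀)))
        + β1' * Complex.exp (Complex.I * ((d 0 * g' : ℝ) * ζ₀)) = 0 := by
    have hne : -β1 / β1' ≠ 0 := div_ne_zero (neg_ne_zero.2 hβ1) hβ1'
    have hqc : (q : ℂ) ≠ 0 := by exact_mod_cast qp.ne'
    refine ⟨Complex.log (-β1 / β1') / (Complex.I * q), ?_⟩
    set z := Complex.log (-β1 / β1') / (Complex.I * q) with hz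
    have e : Complex.I * ((d 0 * g' : ℝ) * z) = -(Complex.I * ((d 0 * g : ℝ) * z)) + Complex.log (-β1 / β1') := by
      have : Complex.log (-β1 / β1') = Complex.I * q * z := by
        rw [hz]; field_simp [Complex.I_ne_zero]
      rw [this, hq]; push_cast; ring
    rw [e, Complex.exp_add, Complex.exp_log hne]
    field_simp
    ring
  have key1 : ∀ (w : ℝ) (n : ℕ), Complex.exp (-(Complex.I * ((w * g : ℝ) * (ζ₀ + n * T)))) =
      Complex.exp (-(Complex.I * ((w * g : ℝ) * ζ₀))) * Complex.exp (-(Complex.I * ((w * g : ℝ) * T))) ^ n := by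
    intro w n
    rw [← Complex.exp_nat_mul, ← Complex.exp_add]; congr 1; ring
  have key2 : ∀ (w : ℝ) (n : ℕ), Complex.exp (Complex.I * ((w * g' : ℝ) * (ζ₀ + n * T))) =
      Complex.exp (Complex.I * ((w * g' : ℝ) * ζ₀)) * Complex.exp (Complex.I * ((w * g' : ℝ) * T)) ^ n := by
    intro w n
    rw [← Complex.exp_nat_mul, ← Complex.exp_add]; congr 1; ring
  have qT : q * T = 2 * Real.pi := by rw [hT]; field_simp
  have key3 : ∀ (m : ℕ), Complex.exp (Complex.I * ((d 0 * m * g' : ℝ) * T)) =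
      Complex.exp (-(Complex.I * ((d 0 * m * g : ℝ) * T))) := by
    intro m
    rw [Complex.exp_eq_exp_iff_exists_int]
    refine ⟨m, ?_⟩
    have : ((q * T : ℝ) : ℂ) = 2 * Real.pi := by rw [qT]; push_cast; ring
    have h2 : (m : ℂ) * (2 * Real.pi * Complex.I) = m * Complex.I * ((q * T : ℝ) : ℂ) := by
      rw [this]; ring
    rw [Int.cast_natCast, h2, hq]; push_cast; ring
  have x1 : ∀ n : ℕ, X 1 (ζ₀ + n * T) = γ1 := by
    intro n
    have k3 := key3 1
    simp only [Nat.cast_one, mul_one] at k3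
    rw [h1, key1, key2, k3]
    linear_combination (Complex.exp (-(Complex.I * ((d 0 * g : ℝ) * T))) ^ n) * hζ₀
  set e1 := Complex.exp (-(Complex.I * ((1 * g : ℝ) * T))) with he1
  set e2 := Complex.exp (Complex.I * ((1 * g' : ℝ) * T)) with he2
  set A := β0 * Complex.exp (-(Complex.I * ((1 * g : ℝ) * ζ₀))) with hA
  set B := β0' * Complex.exp (Complex.I * ((1 * g' : ℝ) * ζ₀)) with hB
  have x0 : ∀ n : ℕ, X 0 (ζ₀ + n * T) = γ0 + A * e1 ^ n + B * e2 ^ n := by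
    intro n
    rw [h0, key1, key2, hA, hB]; ring
  set m := Complex.exp (-(Complex.I * ((d 0 * d 1 * g : ℝ) * T))) with hm
  obtain ⟨c, x2⟩ : ∃ c, ∀ n : ℕ, X 2 (ζ₀ + n * T) = γ2 + c * m ^ n := by
    refine ⟨β2 * Complex.exp (-(Complex.I * ((d 0 * d 1 * g : ℝ) * ζ₀))) +
      β2' * Complex.exp (Complex.I * ((d 0 * d 1 * g' : ℝ) * ζ₀)), fun n => ?_⟩
    rw [h2, key1, key2, key3]; ring
  have hs : ∀ s : ℝ, Complex.I * ((1 * s : ℝ) * T) = Complex.I * ((2 * Real.pi * (s / q) : ℝ) : ℂ) := by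
    intro s; rw [hT]; push_cast; ring
  have hlt : ∀ s : ℝ, 0 < s → s ≤ g + g' → Complex.exp (Complex.I * ((1 * s : ℝ) * T)) ≠ 1 := by
    intro s hs0 hs1
    rw [hs]
    refine expo_ne_one (by positivity) ?_
    rw [div_lt_one qp, hq]
    nlinarith
  refine three_exp (u := a * A) (v := a * B) (c := c) (k := p.eval γ1 - a * γ0 - γ2) (e1 := e1) (e2 := e2) (m := m)
    (mul_ne_zero ha (mul_ne_zero hβ0 (Complex.exp_ne_zero _)))
    (mul_ne_zero ha (mul_ne_zero hβ0' (Complex.exp_ne_zero _))) ?_ ?_ ?_ ?_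
  · intro h
    have := hlt g hg (by linarith)
    apply this
    rw [he1, Complex.exp_neg, inv_eq_one] at h
    exact h
  · exact hlt g' hg' (by linarith)
  · intro h
    apply hlt (g + g') (by positivity) le_rfl
    have : Complex.I * ((1 * (g + g') : ℝ) * (T:ℂ)) = Complex.I * ((1 * g' : ℝ) * T) - (-(Complex.I * ((1 * g : ℝ) * T))) := by
      push_cast; ring
    rw [this, Complex.exp_sub, ← he2, ← he1, h]
    exact div_self (Complex.exp_ne_zero _)
  · intro n
    have r := hrec (ζ₀ + n * T)
    rw [x0, x1, x2] at r
    linear_combination r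

end Esc


/-- Recurrence data coming from a periodic composition of Hénon maps. -/
structure HRec (K : ℕ) (lam : ℝ) (p : ℕ → Polynomial ℂ) (a : ℕ → ℂ) (X : ℕ → ℂ → ℂ) : Prop where
  hK : 1 ≤ K
  hlam : 1 < lam
  hd : ∀ i, 2 ≤ (p i).natDegree
  pper : ∀ i, p (i + K) = p i
  ha : ∀ i, a i ≠ 0
  aper : ∀ i, a (i + K) = a i
  hX : ∀ i, Differentiable ℂ (X i)
  hsc : ∀ i ζ, X (i + K) ζ = X i (lam * ζ)
  hrec : ∀ i ζ, X (i + 2) ζ = (p (i + 1)).eval (X (i + 1) ζ) - a (i + 1) * X i ζ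

lemma periodic_bound {K : ℕ} (hK : 1 ≤ K) (f : ℕ → ℝ) (hf : ∀ i, f (i + K) = f i) :
    ∃ M, 0 ≤ M ∧ ∀ i, f i ≤ M := by
  refine ⟨∑ i ∈ Finset.range K, |f i|, Finset.sum_nonneg fun _ _ => abs_nonneg _, fun i => ?_⟩
  have hp : Function.Periodic f K := hf
  rw [← hp.map_mod_nat i]
  refine (le_abs_self _).trans ?_
  exact Finset.single_le_sum (f := fun i => |f i|) (fun _ _ => abs_nonneg _)
    (Finset.mem_range.2 (Nat.mod_lt _ hK))

/-- sum of the norms of the lower coefficients -/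
def lowSum (p : Polynomial ℂ) : ℝ := ∑ i ∈ Finset.range p.natDegree, ‖p.coeff i‖

lemma lowSum_bound (p : Polynomial ℂ) {x : ℂ} (hx : 1 ≤ ‖x‖) :
    ‖p.eval x - p.leadingCoeff * x ^ p.natDegree‖ ≤ lowSum p * ‖x‖ ^ (p.natDegree - 1) := by
  rw [Polynomial.eval_eq_sum_range, Finset.sum_range_succ, Polynomial.leadingCoeff, add_sub_cancel_right,
    lowSum, Finset.sum_mul]
  refine norm_sum_le_of_le _ fun i hi => ?_
  rw [norm_mul, norm_pow]
  have := Finset.mem_range.1 hi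
  gcongr
  omega

lemma eval_bound (p : Polynomial ℂ) {x : ℂ} {R : ℝ} (hx : ‖x‖ ≤ R) :
    ‖p.eval x‖ ≤ ∑ i ∈ Finset.range (p.natDegree + 1), ‖p.coeff i‖ * R ^ i := by
  rw [Polynomial.eval_eq_sum_range]
  refine norm_sum_le_of_le _ fun i hi => ?_
  rw [norm_mul, norm_pow]
  gcongr

section single
variable {p : Polynomial ℂ} {a x y : ℂ} {S A N R : ℝ}

lemma henon_close (hd : 2 ≤ p.natDegree) (hS : lowSum p ≤ S) (hA : ‖a‖ ≤ A)
    (hx : 1 ≤ ‖x‖) (hy : ‖y‖ ≤ ‖x‖) :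
    ‖p.eval x - a * y - p.leadingCoeff * x ^ p.natDegree‖ ≤ (S + A) * ‖x‖ ^ (p.natDegree - 1) := by
  have h1 := lowSum_bound p hx
  have h2 : ‖a * y‖ ≤ A * ‖x‖ ^ (p.natDegree - 1) := by
    rw [norm_mul]
    have : ‖x‖ ≤ ‖x‖ ^ (p.natDegree - 1) := le_self_pow₀ hx (by omega)
    have hA0 : 0 ≤ A := (norm_nonneg _).trans hA
    exact mul_le_mul hA (hy.trans this) (norm_nonneg _) hA0
  have h3 : lowSum p * ‖x‖ ^ (p.natDegree - 1) ≤ S * ‖x‖ ^ (p.natDegree - 1) := by gcongr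
  calc _ = ‖(p.eval x - p.leadingCoeff * x ^ p.natDegree) - a * y‖ := by congr 1; ring
    _ ≤ _ := norm_sub_le _ _
    _ ≤ _ := by rw [add_mul]; linarith

lemma lead_big (hd : 2 ≤ p.natDegree) (hN0 : 0 < N) (hN : ‖p.leadingCoeff‖⁻¹ ≤ N)
    (hR : N * (S + 2 + 2 * A) ≤ R) (hx : R ≤ ‖x‖) (hx1 : 1 ≤ ‖x‖) :
    (S + 2 + 2 * A) * ‖x‖ ^ (p.natDegree - 1) ≤ ‖p.leadingCoeff * x ^ p.natDegree‖ := by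
  have hl : 0 < ‖p.leadingCoeff‖ := by
    rw [norm_pos_iff, Polynomial.leadingCoeff_ne_zero]; rintro rfl; simp at hd
  have h1 : 1 ≤ N * ‖p.leadingCoeff‖ := by
    rw [inv_le_iff_one_le_mul₀ hl] at hN; exact hN
  have h2 : S + 2 + 2 * A ≤ ‖p.leadingCoeff‖ * ‖x‖ := by
    have h3 : N * (S + 2 + 2 * A) ≤ N * (‖p.leadingCoeff‖ * ‖x‖) := by
      nlinarith
    exact le_of_mul_le_mul_left h3 hN0
  have h4 : ‖x‖ ^ p.natDegree = ‖x‖ * ‖x‖ ^ (p.natDegree - 1) := by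
    rw [← pow_succ']; congr 1; omega
  rw [norm_mul, norm_pow, h4, ← mul_assoc]
  gcongr

lemma henon_grow (hd : 2 ≤ p.natDegree) (hS : lowSum p ≤ S) (hA : ‖a‖ ≤ A)
    (hN0 : 0 < N) (hN : ‖p.leadingCoeff‖⁻¹ ≤ N)
    (hR : N * (S + 2 + 2 * A) ≤ R) (hx : R ≤ ‖x‖) (hx1 : 1 ≤ ‖x‖) (hy : ‖y‖ ≤ ‖x‖) :
    2 * ‖x‖ ≤ ‖p.eval x - a * y‖ := by
  have h1 := henon_close hd hS hA hx1 hy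
  have h2 := lead_big hd hN0 hN hR hx hx1
  have h3 := norm_sub_norm_le (p.leadingCoeff * x ^ p.natDegree) (p.leadingCoeff * x ^ p.natDegree - (p.eval x - a * y))
  rw [sub_sub_cancel, norm_sub_rev (p.leadingCoeff * x ^ p.natDegree)] at h3
  have : ‖x‖ ≤ ‖x‖ ^ (p.natDegree - 1) := le_self_pow₀ hx1 (by omega)
  have hA0 : 0 ≤ A := (norm_nonneg _).trans hA
  nlinarith

lemma henon_back (hd : 2 ≤ p.natDegree) (hS : lowSum p ≤ S) (hA : ‖a‖ ≤ A)
    (hN0 : 0 < N) (hN : ‖p.leadingCoeff‖⁻¹ ≤ N)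
    (hR : N * (S + 2 + 2 * A) ≤ R) (hx : R ≤ ‖x‖) (hx1 : 1 ≤ ‖x‖)
    (hy : ‖p.eval x - a * y‖ ≤ ‖x‖) :
    2 * ‖x‖ ≤ ‖y‖ := by
  have h1 := lowSum_bound p hx1
  have h1' : lowSum p * ‖x‖ ^ (p.natDegree - 1) ≤ S * ‖x‖ ^ (p.natDegree - 1) := by gcongr
  have h2 := lead_big hd hN0 hN hR hx hx1
  have h3 : ‖p.leadingCoeff * x ^ p.natDegree‖ ≤
      ‖p.eval x - a * y‖ + ‖a * y‖ + ‖p.eval x - p.leadingCoeff * x ^ p.natDegree‖ := by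
    calc _ = ‖(p.eval x - a * y) + a * y - (p.eval x - p.leadingCoeff * x ^ p.natDegree)‖ := by
          congr 1; ring
      _ ≤ _ := (norm_sub_le _ _).trans (by gcongr; exact norm_add_le _ _)
  have h4 : ‖x‖ ≤ ‖x‖ ^ (p.natDegree - 1) := le_self_pow₀ hx1 (by omega)
  have hA0 : 0 ≤ A := (norm_nonneg _).trans hA
  have h5 : ‖a * y‖ ≤ A * ‖y‖ := by rw [norm_mul]; gcongr
  by_contra! hc
  have h6 : A * ‖y‖ ≤ A * (2 * ‖x‖) := by gcongr
  nlinarith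

end single

namespace HRec
variable {K : ℕ} {lam : ℝ} {p : ℕ → Polynomial ℂ} {a : ℕ → ℂ} {X : ℕ → ℂ → ℂ}

lemma sc_pow (H : HRec K lam p a X) (i m : ℕ) (ζ : ℂ) : X (i + m * K) ζ = X i ((lam : ℂ) ^ m * ζ) := by
  induction m generalizing ζ with
  | zero => simp
  | succ m ih =>
    rw [show i + (m + 1) * K = i + m * K + K by ring, H.hsc, ih]
    congr 1; ring

lemma prev (H : HRec K lam p a X) (i : ℕ) (ζ : ℂ) : ∃ i' ζ', X (i' + 1) ζ' = X i ζ ∧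
    X (i + 1) ζ = (p i).eval (X i ζ) - a i * X i' ζ' := by
  have hl : (lam : ℂ) ≠ 0 := by exact_mod_cast (by linarith [H.hlam] : lam ≠ 0)
  obtain ⟨k, rfl⟩ : ∃ k, K = k + 1 := ⟨K - 1, by have := H.hK; omega⟩
  have e1 : X (i + k + 1) (ζ / lam) = X i ζ := by
    have := H.hsc i (ζ / lam)
    rw [mul_div_cancel₀ _ hl] at this
    exact this
  have e2 : X (i + k + 2) (ζ / lam) = X (i + 1) ζ := by
    have := H.hsc (i + 1) (ζ / lam)
    rw [mul_div_cancel₀ _ hl] at this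
    rw [← this]; congr 1; omega
  refine ⟨i + k, ζ / lam, e1, ?_⟩
  rw [← e2, H.hrec, e1]
  have q1 := H.pper i
  have q2 := H.aper i
  rw [← add_assoc] at q1 q2
  rw [q1, q2]

lemma no_back (H : HRec K lam p a X) {R : ℝ} (hR1 : 1 ≤ R)
    (hb : ∀ i ζ, R ≤ ‖X (i + 1) ζ‖ → ‖X (i + 2) ζ‖ ≤ ‖X (i + 1) ζ‖ → 2 * ‖X (i + 1) ζ‖ ≤ ‖X i ζ‖)
    (i : ℕ) (ζ : ℂ) (h : R ≤ ‖X i ζ‖) : ‖X i ζ‖ < ‖X (i + 1) ζ‖ := by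
  by_contra! hc
  have hl : (lam : ℂ) ≠ 0 := by exact_mod_cast (by linarith [H.hlam] : lam ≠ 0)
  have key : ∀ m i ζ, R ≤ ‖X (i + m) ζ‖ → ‖X (i + m + 1) ζ‖ ≤ ‖X (i + m) ζ‖ →
      2 ^ m * R ≤ ‖X i ζ‖ := by
    intro m
    induction m with
    | zero => intro i ζ h1 h2; simpa using h1
    | succ m ih =>
      intro i ζ h1 h2
      have h3 := hb (i + m) ζ h1 h2
      have h4 : R ≤ ‖X (i + m) ζ‖ := by
        have : R ≤ ‖X (i + m + 1) ζ‖ := h1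
        linarith
      have h4' : R ≤ ‖X (i + m + 1) ζ‖ := h1
      have : 2 * (2 ^ m * R) ≤ ‖X i ζ‖ := by
        have aux : ∀ m i ζ, ‖X (i + m + 1) ζ‖ ≤ ‖X (i + m) ζ‖ → R ≤ ‖X (i + m) ζ‖ →
            2 ^ m * ‖X (i + m) ζ‖ ≤ ‖X i ζ‖ := by
          intro m
          induction m with
          | zero => intro i ζ _ _; simp
          | succ m ih2 =>
            intro i ζ g1 g2
            have g3 := hb (i + m) ζ g2 g1
            have g2' : R ≤ ‖X (i + m + 1) ζ‖ := g2
            have g4 := ih2 i ζ (by linarith) (by linarith)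
            have : (2:ℝ) ^ m * (2 * ‖X (i + m + 1) ζ‖) ≤ 2 ^ m * ‖X (i + m) ζ‖ := by gcongr
            rw [pow_succ, ← add_assoc]; linarith
        have g := aux m i ζ (by linarith) h4
        have : (2:ℝ) ^ m * (2 * R) ≤ 2 ^ m * ‖X (i + m) ζ‖ := by
          gcongr; linarith
        linarith
      rw [pow_succ]; linarith
  have hm : ∀ m : ℕ, (2:ℝ) ^ m ≤ ‖X i (ζ / (lam : ℂ) ^ m)‖ := by
    intro m
    have e : ∀ i, X (i + m * K) (ζ / (lam : ℂ) ^ m) = X i ζ := by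
      intro i
      rw [H.sc_pow, mul_div_cancel₀ _ (pow_ne_zero _ hl)]
    have h1 := key (m * K) i (ζ / (lam : ℂ) ^ m) (by rw [e]; exact h)
      (by rw [e, add_right_comm, e]; exact hc)
    refine le_trans ?_ h1
    have : (2:ℝ) ^ m ≤ 2 ^ (m * K) := by
      gcongr
      · norm_num
      · exact Nat.le_mul_of_pos_right _ H.hK
    nlinarith [pow_pos (two_pos (α := ℝ)) (m * K)]
  have ht : Tendsto (fun m : ℕ => ‖X i (ζ / (lam : ℂ) ^ m)‖) atTop (𝓝 ‖X i 0‖) := by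
    have h0 : Tendsto (fun m : ℕ => ζ / (lam : ℂ) ^ m) atTop (𝓝 0) := by
      have h1 : Tendsto (fun m : ℕ => ((lam : ℂ)⁻¹) ^ m) atTop (𝓝 0) := by
        apply tendsto_pow_atTop_nhds_zero_of_norm_lt_one
        rw [norm_inv, Complex.norm_real, Real.norm_of_nonneg (by linarith [H.hlam])]
        exact inv_lt_one_of_one_lt₀ H.hlam
      have h2 := h1.const_mul ζ
      rw [mul_zero] at h2
      refine h2.congr fun m => ?_
      rw [inv_pow, div_eq_mul_inv]
    exact (((H.hX i).continuous.norm).tendsto 0).comp h0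
  have ht2 : Tendsto (fun m : ℕ => ‖X i (ζ / (lam : ℂ) ^ m)‖) atTop atTop :=
    tendsto_atTop_mono hm (tendsto_pow_atTop_atTop_of_one_lt one_lt_two)
  exact not_tendsto_nhds_of_tendsto_atTop ht2 _ ht

lemma exists_esc (H : HRec K lam p a X) : ∃ R R' C L,
    Esc K lam (fun i => (p i).natDegree) (fun i => (p i).leadingCoeff) X R R' C L := by
  obtain ⟨S, hS0, hS⟩ := periodic_bound H.hK (fun i => lowSum (p i)) (fun i => by simp only [H.pper])
  obtain ⟨A, hA0, hA⟩ := periodic_bound H.hK (fun i => ‖a i‖) (fun i => by simp only [H.aper])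
  obtain ⟨N', hN0', hN'⟩ := periodic_bound H.hK (fun i => ‖(p i).leadingCoeff‖⁻¹) (fun i => by simp only [H.pper])
  obtain ⟨L, hL0, hL⟩ := periodic_bound H.hK (fun i => ‖Complex.log (p i).leadingCoeff‖ + 1)
    (fun i => by simp only [H.pper])
  set N := N' + 1 with hNdef
  have hN0 : 0 < N := by linarith
  have hN : ∀ i, ‖(p i).leadingCoeff‖⁻¹ ≤ N := fun i => (hN' i).trans (by linarith)
  set C := (S + A) * N with hC
  have hC0 : 0 ≤ C := by positivity
  set R := 1 + 2 * C + Real.exp (L + 1) + N * (S + 2 + 2 * A) with hR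
  have hE := Real.exp_pos (L + 1)
  have hQ : 0 ≤ N * (S + 2 + 2 * A) := by positivity
  have hR1 : 1 ≤ R := by linarith
  have hRN : N * (S + 2 + 2 * A) ≤ R := by linarith
  obtain ⟨M, hM0, hM⟩ := periodic_bound H.hK
    (fun i => ∑ k ∈ Finset.range ((p i).natDegree + 1), ‖(p i).coeff k‖ * R ^ k)
    (fun i => by simp only [H.pper])
  have nb := H.no_back hR1 (fun i ζ h1 h2 => by
    rw [H.hrec] at h2
    exact henon_back (H.hd _) (hS _) (hA _) hN0 (hN _) hRN h1 (hR1.trans h1) h2)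
  have hpv : ∀ i ζ, ∃ y, X (i + 1) ζ = (p i).eval (X i ζ) - a i * y ∧
      (R ≤ ‖X i ζ‖ → ‖y‖ ≤ ‖X i ζ‖) ∧ (‖X i ζ‖ ≤ R → ‖y‖ ≤ R) := by
    intro i ζ
    obtain ⟨i', ζ', e1, e2⟩ := H.prev i ζ
    have n := nb i' ζ'
    refine ⟨X i' ζ', e2, fun h => ?_, fun h => ?_⟩
    · rw [← e1] at h ⊢
      by_contra! hc
      linarith [n (by linarith)]
    · rw [← e1] at h
      by_contra! hc
      linarith [n (by linarith)]
  refine ⟨R, R + M + A * R, C, L, ?_⟩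
  refine
    { hK := H.hK
      hlam := H.hlam
      hd := H.hd
      hdper := fun i => congrArg Polynomial.natDegree (H.pper i)
      hα := ?_
      hαper := fun i => congrArg Polynomial.leadingCoeff (H.pper i)
      hX := H.hX
      hsc := H.hsc
      hR1 := hR1
      hRR' := ?_
      hC0 := hC0
      hCR := ?_
      hL := hL
      hLR := ?_
      F1 := ?_
      F2 := ?_
      F3 := ?_ }
  · intro i; rw [Ne, Polynomial.leadingCoeff_eq_zero]; intro h; have := H.hd i; rw [h] at this; simp at this
  · have : 0 ≤ A * R := by positivity
    linarith
  · linarith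
  · rw [Real.lt_log_iff_exp_lt (by linarith)]
    have : Real.exp L < Real.exp (L + 1) := Real.exp_lt_exp.2 (by linarith)
    linarith
  · intro i ζ h
    obtain ⟨y, e, h1, -⟩ := hpv i ζ
    rw [e]
    exact henon_grow (H.hd _) (hS _) (hA _) hN0 (hN _) hRN h (hR1.trans h) (h1 h)
  · intro i ζ h
    obtain ⟨y, e, h1, -⟩ := hpv i ζ
    have hx0 : 0 < ‖X i ζ‖ := by linarith
    have hl : (p i).leadingCoeff ≠ 0 := by
      rw [Ne, Polynomial.leadingCoeff_eq_zero]; intro h; have := H.hd i; rw [h] at this; simp at this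
    have hne : (p i).leadingCoeff * X i ζ ^ (p i).natDegree ≠ 0 :=
      mul_ne_zero hl (pow_ne_zero _ (norm_pos_iff.1 hx0))
    have hc := henon_close (H.hd i) (hS i) (hA i) (hR1.trans h) (h1 h)
    rw [← e] at hc
    rw [div_sub_one hne, norm_div, norm_mul, norm_pow]
    have h4 : ‖X i ζ‖ ^ (p i).natDegree = ‖X i ζ‖ * ‖X i ζ‖ ^ ((p i).natDegree - 1) := by
      rw [← pow_succ']; congr 1; have := H.hd i; omega
    have hl0 : 0 < ‖(p i).leadingCoeff‖ := norm_pos_iff.2 hl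
    have hN1 : 1 ≤ N * ‖(p i).leadingCoeff‖ := by
      have := hN i
      rwa [inv_le_iff_one_le_mul₀ hl0] at this
    rw [div_le_div_iff₀ (by positivity) hx0, h4, hC]
    have hSA : 0 ≤ (S + A) * ‖X i ζ‖ ^ ((p i).natDegree - 1) * ‖X i ζ‖ := by positivity
    calc _ ≤ (S + A) * ‖X i ζ‖ ^ ((p i).natDegree - 1) * ‖X i ζ‖ := by gcongr
      _ ≤ ((S + A) * ‖X i ζ‖ ^ ((p i).natDegree - 1) * ‖X i ζ‖) * (N * ‖(p i).leadingCoeff‖) :=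
        le_mul_of_one_le_right hSA hN1
      _ = _ := by ring
  · intro i ζ h
    obtain ⟨y, e, -, h1⟩ := hpv i ζ
    rw [e]
    have b1 := (eval_bound (p i) h).trans (hM i)
    have b2 : ‖a i * y‖ ≤ A * R := by
      rw [norm_mul]; exact mul_le_mul (hA i) (h1 h) (norm_nonneg _) hA0
    linarith [norm_sub_le ((p i).eval (X i ζ)) (a i * y)]

/-- The main contradiction for recurrence data. -/
lemma contra (H : HRec K lam p a X) (A : Set ℂ)
    (hA : ∀ ζ, ζ ∈ A ↔ ∃ M, ∀ j, ‖X j ζ‖ ≤ M)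
    (hfr : frontier A = {w : ℂ | w.im = 0}) : False := by
  obtain ⟨R, R', C, L, E⟩ := H.exists_esc
  have hA' : ∀ ζ, ζ ∈ A ↔ ∀ j, ‖X j ζ‖ ≤ R := by
    intro ζ
    rw [hA]
    refine ⟨fun ⟨M, hM⟩ j => ?_, fun h => ⟨R, h⟩⟩
    by_contra! hc
    have hg : ∀ m : ℕ, (2:ℝ) ^ m * R ≤ ‖X (j + m) ζ‖ := by
      intro m
      induction m with
      | zero => simpa using hc.le
      | succ m ih =>
        have : R ≤ ‖X (j + m) ζ‖ := le_trans (le_mul_of_one_le_left (by linarith [E.hR1])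
          (one_le_pow₀ one_le_two)) ih
        have := E.F1 _ _ this
        rw [← add_assoc, pow_succ]; linarith
    obtain ⟨m, hm⟩ := pow_unbounded_of_one_lt M (one_lt_two (α := ℝ))
    have h1 := hg m
    have h2 := hM (j + m)
    have : (2:ℝ) ^ m ≤ 2 ^ m * R := le_mul_of_one_le_right (by positivity) E.hR1
    linarith
  have hAn : ∀ ζ, ζ ∉ A ↔ ∃ j, R < ‖X j ζ‖ := by
    intro ζ; rw [hA']; push Not; rfl
  have hAc : IsClosed A := by
    have : A = ⋂ j, {ζ | ‖X j ζ‖ ≤ R} := by ext ζ; simp [hA']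
    rw [this]
    exact isClosed_iInter fun j => isClosed_le (E.hX j).continuous.norm continuous_const
  have hreal : ∀ (t : ℝ), (t : ℂ) ∈ A := by
    intro t
    apply hAc.frontier_subset
    rw [hfr]; simp
  -- half planes
  have hhp : ∀ U : Set ℂ, IsPreconnected U → (∀ ζ ∈ U, ζ.im ≠ 0) → U ⊆ A ∨ U ⊆ Aᶜ := by
    intro U hU hi
    by_contra! hc
    obtain ⟨h1, h2⟩ := hc
    rw [not_subset] at h1 h2
    obtain ⟨x, hx, hxA⟩ := h1
    obtain ⟨y, hy, hyA⟩ := h2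
    have hinter : ∀ z ∈ U, z ∈ A → z ∈ interior A := by
      intro z hz hzA
      by_contra hzi
      have : z ∈ frontier A := by rw [hAc.frontier_eq]; exact ⟨hzA, hzi⟩
      rw [hfr] at this
      exact hi z hz this
    obtain ⟨z, -, hz1, hz2⟩ := hU (interior A) Aᶜ isOpen_interior hAc.isOpen_compl
      (fun z hz => by
        by_cases hzA : z ∈ A
        · exact Or.inl (hinter z hz hzA)
        · exact Or.inr hzA)
      ⟨y, hy, hinter y hy (not_not.1 hyA)⟩ ⟨x, hx, hxA⟩
    exact hz2 (interior_subset hz1)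
  have hup := hhp {ζ | 0 < ζ.im} (convex_halfSpace_im_gt 0).isPreconnected (fun ζ h => ne_of_gt h)
  have hdn := hhp {ζ | ζ.im < 0} (convex_halfSpace_im_lt 0).isPreconnected (fun ζ h => ne_of_lt h)
  have hreal0 : ∀ ζ : ℂ, ζ.im = 0 → ζ ∈ A := by
    intro ζ h
    have : ζ = (ζ.re : ℂ) := by apply Complex.ext <;> simp [h]
    rw [this]; exact hreal _
  have r := H.hrec 0
  rcases hup with hu | hu <;> rcases hdn with hd | hd
  · have : A = univ := by
      ext ζ
      simp only [mem_univ, iff_true]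
      rcases lt_trichotomy ζ.im 0 with h | h | h
      · exact hd h
      · exact hreal0 ζ h
      · exact hu h
    rw [this, frontier_univ] at hfr
    have : (0:ℂ) ∈ (∅ : Set ℂ) := by rw [hfr]; simp
    exact this
  · refine E.neg.final1 (fun ζ h => (hAn (-ζ)).1 (hd (by simpa using h))) (fun ζ h => (hA' (-ζ)).1 ?_)
      (p 1) (a 1) (H.ha 1) (fun ζ => r (-ζ))
    rcases lt_or_eq_of_le h with h | h
    · exact hu (by simpa using h)
    · exact hreal0 _ (by simpa using h)
  · refine E.final1 (fun ζ h => (hAn ζ).1 (hu h)) (fun ζ h => (hA' ζ).1 ?_)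
      (p 1) (a 1) (H.ha 1) r
    rcases lt_or_eq_of_le h with h | h
    · exact hd h
    · exact hreal0 _ h
  · exact E.final2 (fun ζ h => (hAn ζ).1 (hu h)) (fun t => (hA' t).1 (hreal t))
      (fun ζ h => (hAn ζ).1 (hd h)) (p 1) (a 1) (H.ha 1) r

end HRec

/-- Orbit of a point under a sequence of maps. -/
def orb {M : Type} (h : ℕ → M → M) : ℕ → M → M
  | 0, z => z
  | j + 1, z => h j (orb h j z)

lemma orb_add {M : Type} (h : ℕ → M → M) (m j : ℕ) (z : M) :
    orb h (m + j) z = orb (fun i => h (m + i)) j (orb h m z) := by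
  induction j with
  | zero => rfl
  | succ j ih => rw [← add_assoc, orb, ih, orb]

lemma orb_list {M : Type} (h : ℕ → M → M) (hs : List (M → M))
    (hh : ∀ i, i < hs.length → hs.reverse[i]? = some (h i)) (z : M) :
    orb h hs.length z = hs.foldr (fun h acc => h ∘ acc) id z := by
  induction hs with
  | nil => rfl
  | cons a t ih =>
    have h1 : h t.length = a := by
      have := hh t.length (by simp)
      simpa using this.symm
    have h2 := ih (fun i hi => by
      have := hh i (by simp; omega)
      rw [List.reverse_cons, List.getElem?_append_left (by simpa using hi)] at this
      exact this)
    rw [List.length_cons, orb, h1, h2]; rfl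

lemma orb_period {M : Type} (h : ℕ → M → M) (k : ℕ) (hper : ∀ i, h (i + k) = h i) (m j : ℕ) (z : M) :
    orb h (m * k + j) z = orb h j ((orb h k)^[m] z) := by
  induction m generalizing z with
  | zero => simp
  | succ m ih =>
    rw [Function.iterate_succ_apply, ← ih, show (m + 1) * k + j = k + (m * k + j) by ring, orb_add]
    congr 1
    funext i
    rw [add_comm, hper]

lemma polyMap_diff {F : ℂ × ℂ → ℂ × ℂ} (hF : IsPolyMap F) : Differentiable ℂ F := by
  obtain ⟨P, Q, h⟩ := hF
  have key : ∀ P : MvPolynomial (Fin 2) ℂ,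
      Differentiable ℂ (fun z : ℂ × ℂ => MvPolynomial.eval ![z.1, z.2] P) := by
    intro P
    induction P using MvPolynomial.induction_on with
    | C a => simp
    | add p q hp hq => simp only [map_add]; exact hp.add hq
    | mul_X p n hp =>
      simp only [map_mul, MvPolynomial.eval_X]
      refine hp.mul ?_
      fin_cases n
      · exact differentiable_fst
      · exact differentiable_snd
  have : F = fun z => (MvPolynomial.eval ![z.1, z.2] P, MvPolynomial.eval ![z.1, z.2] Q) := funext h
  rw [this]
  exact (key P).prodMk (key Q)

lemma bdd_image {F : ℂ × ℂ → ℂ × ℂ} (hF : Continuous F) (M : ℝ) :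
    ∃ M', ∀ z, ‖z‖ ≤ M → ‖F z‖ ≤ M' := by
  obtain ⟨C, hC⟩ := (isCompact_closedBall (0 : ℂ × ℂ) M).exists_bound_of_continuousOn hF.continuousOn
  exact ⟨C, fun z hz => hC z (by simpa using hz)⟩

lemma Kplus_iterate (f : ℂ × ℂ → ℂ × ℂ) (n : ℕ) (z : ℂ × ℂ) :
    f^[n] z ∈ Kplus f ↔ z ∈ Kplus f := by
  constructor
  · rintro ⟨C, hC⟩
    refine ⟨|C| + ∑ i ∈ Finset.range n, ‖f^[i] z‖, fun m => ?_⟩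
    have h0 : 0 ≤ ∑ i ∈ Finset.range n, ‖f^[i] z‖ := Finset.sum_nonneg fun _ _ => norm_nonneg _
    rcases lt_or_ge m n with h | h
    · have := Finset.single_le_sum (f := fun i => ‖f^[i] z‖) (fun _ _ => norm_nonneg _)
        (Finset.mem_range.2 h)
      linarith [abs_nonneg C]
    · have := hC (m - n)
      rw [← Function.iterate_add_apply, Nat.sub_add_cancel h] at this
      linarith [le_abs_self C]
  · rintro ⟨C, hC⟩
    refine ⟨C, fun m => ?_⟩
    rw [← Function.iterate_add_apply]
    exact hC _

/-- unstably linear loxodromic automorphisms of `ℂ²` do not exist: no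
saddle periodic point has an unstable parametrization `ψ` such that the frontier of
`ψ⁻¹(K⁺)` is a real line through the origin. -/
theorem no_unstably_linear (f : ℂ × ℂ → ℂ × ℂ) (hf : IsLoxodromic f) :
    ¬ ∃ (p : ℂ × ℂ) (n : ℕ) (ls lu : ℂ) (ψ : ℂ → ℂ × ℂ) (v : ℂ),
      IsSaddle f p n ls lu ∧ IsUnstableParam f n lu p ψ ∧ v ≠ 0 ∧
      frontier (ψ ⁻¹' Kplus f) = {w : ℂ | ∃ t : ℝ, w = (t : ℂ) * v} := by
  rintro ⟨p₀, n, ls, lu, ψ, v, ⟨hn, -, -, -, -, hlu⟩, ⟨-, hψd, -, hψ⟩, hv, hfr⟩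
  obtain ⟨-, u, uinv, hs, ⟨hu, ui, hui, hui1, -⟩, hinv1, hinv2, hne, hH, hfu⟩ := hf
  have hud := polyMap_diff hu
  have huinv : uinv = ui := by
    funext z
    rw [← hui1 (uinv z), hinv2]
  have huid : Continuous uinv := by rw [huinv]; exact (polyMap_diff hui).continuous
  have hlu0 : lu ≠ 0 := by rintro rfl; norm_num at hlu
  -- the multiplier is real
  set A₀ := ψ ⁻¹' Kplus f with hA₀
  have hinvA : (Homeomorph.mulLeft₀ lu hlu0) ⁻¹' A₀ = A₀ := by
    ext ζ
    change ψ (lu * ζ) ∈ Kplus f ↔ ψ ζ ∈ Kplus f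
    rw [← hψ, Kplus_iterate]
  obtain ⟨t, ht⟩ : ∃ t : ℝ, lu = t := by
    have h1 : v ∈ frontier A₀ := by rw [hfr]; exact ⟨1, by simp⟩
    rw [← hinvA, ← Homeomorph.preimage_frontier, hfr] at h1
    obtain ⟨t, ht⟩ := h1
    exact ⟨t, mul_right_cancel₀ hv ht⟩
  have hlam : 1 < t ^ 2 := by
    rw [ht, Complex.norm_real, Real.norm_eq_abs] at hlu
    exact (one_lt_sq_iff_one_lt_abs t).2 hlu
  set A := (Homeomorph.mulLeft₀ v hv) ⁻¹' A₀ with hA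
  have hfrA : frontier A = {w : ℂ | w.im = 0} := by
    rw [hA, ← Homeomorph.preimage_frontier, hfr]
    ext w
    change (∃ t : ℝ, v * w = t * v) ↔ w.im = 0
    constructor
    · rintro ⟨t, h⟩
      have : w = t := mul_left_cancel₀ hv (by rw [h]; ring)
      rw [this]; simp
    · intro h
      refine ⟨w.re, ?_⟩
      have : w = (w.re : ℂ) := by apply Complex.ext <;> simp [h]
      rw [mul_comm, ← this]
  -- the Hénon maps
  set k := hs.length with hk
  have hk1 : 1 ≤ k := List.length_pos_iff.2 hne
  set h : ℕ → (ℂ × ℂ → ℂ × ℂ) := fun j => hs.reverse.getD (j % k) id with hh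
  have hper : ∀ i, h (i + k) = h i := fun i => by simp only [hh, Nat.add_mod_right]
  have hget : ∀ i, i < k → hs.reverse[i]? = some (h i) := by
    intro i hi
    have hi' : i < hs.reverse.length := by simpa using hi
    simp only [hh, Nat.mod_eq_of_lt hi, List.getD_eq_getElem?_getD, List.getElem?_eq_getElem hi',
      Option.getD_some]
  have hHen : ∀ i, IsHenon (h i) := by
    intro i
    have h1 : i % k < k := Nat.mod_lt _ hk1
    have h2 := hget _ h1
    have h3 : h (i % k) = h i := by simp only [hh, Nat.mod_mod]
    rw [h3] at h2
    exact hH _ (List.mem_reverse.1 (List.mem_of_getElem? h2))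
  set G := hs.foldr (fun h acc => h ∘ acc) id with hG
  have hGo : orb h k = G := funext fun z => orb_list h hs hget z
  obtain ⟨Pf, Af, hPA⟩ : ∃ (Pf : (ℂ × ℂ → ℂ × ℂ) → Polynomial ℂ) (Af : (ℂ × ℂ → ℂ × ℂ) → ℂ),
      ∀ g, IsHenon g → Af g ≠ 0 ∧ 2 ≤ (Pf g).natDegree ∧
        ∀ z : ℂ × ℂ, g z = (Polynomial.eval z.1 (Pf g) - Af g * z.2, z.1) := by
    have : ∀ g : ℂ × ℂ → ℂ × ℂ, ∃ (p : Polynomial ℂ) (a : ℂ), IsHenon g → a ≠ 0 ∧ 2 ≤ p.natDegree ∧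
        ∀ z : ℂ × ℂ, g z = (Polynomial.eval z.1 p - a * z.2, z.1) := by
      intro g
      by_cases hg : IsHenon g
      · obtain ⟨p, a, hpa⟩ := hg
        exact ⟨p, a, fun _ => hpa⟩
      · exact ⟨0, 0, fun h => absurd h hg⟩
    choose Pf Af hPA using this
    exact ⟨Pf, Af, hPA⟩
  have hhd : ∀ i, Differentiable ℂ (h i) := by
    intro i
    have e : h i = fun z => (Polynomial.eval z.1 (Pf (h i)) - Af (h i) * z.2, z.1) :=
      funext (hPA _ (hHen i)).2.2
    rw [e]
    have := (Pf (h i)).differentiable.comp (differentiable_fst (𝕜 := ℂ) (E := ℂ) (F := ℂ))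
    refine Differentiable.prodMk (Differentiable.sub this ?_) differentiable_fst
    exact differentiable_snd.const_mul _
  have hod : ∀ j, Differentiable ℂ (orb h j) := by
    intro j
    induction j with
    | zero => exact differentiable_id
    | succ j ih => exact (hhd j).comp ih
  -- conjugacy
  have hfG : ∀ m z, u (f^[m] z) = G^[m] (u z) := by
    intro m z
    have hsc : Function.Semiconj u f G := fun z => by rw [hfu, hinv2]
    exact hsc.iterate_right m z
  set z₀ : ℂ → ℂ × ℂ := fun ζ => u (ψ (v * ζ)) with hz₀
  have hz₀d : Differentiable ℂ z₀ := hud.comp (hψd.comp (differentiable_id.const_mul v))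
  have hGz : ∀ ζ, G^[n] (z₀ ζ) = z₀ (lu * ζ) := by
    intro ζ
    simp only [hz₀]
    rw [← hfG, hψ]; congr 2; ring
  have hGz2 : ∀ ζ, G^[n * 2] (z₀ ζ) = z₀ ((t ^ 2 : ℝ) * ζ) := by
    intro ζ
    rw [mul_two, Function.iterate_add_apply, hGz, hGz]
    congr 1; rw [ht]; push_cast; ring
  set K := n * 2 * k with hK
  have hK1 : 1 ≤ K := Nat.mul_pos (Nat.mul_pos hn two_pos) hk1
  have hperK : ∀ i, h (i + K) = h i := by
    intro i
    simp only [hh, hK, Nat.add_mul_mod_self_right]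
  have hX1 : ∀ j z, (orb h (j + 1) z).2 = (orb h j z).1 := by
    intro j z
    rw [orb, (hPA _ (hHen j)).2.2]
  have H : HRec K (t ^ 2) (fun i => Pf (h (i + K - 1))) (fun i => Af (h (i + K - 1)))
      (fun j ζ => (orb h j (z₀ ζ)).2) := by
    have e1 : ∀ i, h (i + K + K - 1) = h (i + K - 1) := by
      intro i
      rw [show i + K + K - 1 = i + K - 1 + K by omega, hperK]
    have e2 : ∀ i, h (i + 1 + K - 1) = h i := by
      intro i
      rw [show i + 1 + K - 1 = i + K by omega, hperK]
    refine
      { hK := hK1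
        hlam := hlam
        hd := fun i => (hPA _ (hHen _)).2.1
        pper := fun i => by simp only [e1]
        ha := fun i => (hPA _ (hHen _)).1
        aper := fun i => by simp only [e1]
        hX := fun i => ((hod i).comp hz₀d).snd
        hsc := ?_
        hrec := ?_ }
    · intro i ζ
      rw [add_comm, hK, orb_period h k hper, hGo, hGz2]
    · intro i ζ
      simp only [e2]
      rw [hX1 (i + 1), hX1 i, orb, (hPA _ (hHen i)).2.2]
  refine H.contra A (fun ζ => ?_) hfrA
  change ψ (v * ζ) ∈ Kplus f ↔ _
  constructor
  · rintro ⟨C, hC⟩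
    obtain ⟨C₁, hC₁⟩ := bdd_image hud.continuous C
    choose M hM using fun r => bdd_image (hod r).continuous C₁
    refine ⟨∑ r ∈ Finset.range k, |M r|, fun j => ?_⟩
    have hj : j = j / k * k + j % k := (Nat.div_add_mod' j k).symm
    have h1 : ‖G^[j / k] (z₀ ζ)‖ ≤ C₁ := by
      rw [← hfG]; exact hC₁ _ (hC _)
    have h2 := hM (j % k) _ h1
    have h3 : orb h j (z₀ ζ) = orb h (j % k) (G^[j / k] (z₀ ζ)) := by
      conv_lhs => rw [hj, orb_period h k hper, hGo]
    rw [h3]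
    refine (norm_snd_le _).trans (h2.trans ((le_abs_self _).trans ?_))
    exact Finset.single_le_sum (f := fun i => |M i|) (fun _ _ => abs_nonneg _)
      (Finset.mem_range.2 (Nat.mod_lt _ hk1))
  · rintro ⟨M, hM⟩
    obtain ⟨C, hC⟩ := bdd_image huid M
    refine ⟨C, fun m => ?_⟩
    rw [← hinv1 (f^[m] _), hfG]
    apply hC
    have h1 := orb_period h k hper m 0 (z₀ ζ)
    rw [hGo, add_zero] at h1
    change _ = G^[m] (u (ψ (v * ζ))) at h1
    rw [← h1, Prod.norm_def]
    refine max_le ?_ (hM _)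
    rw [← hX1]; exact hM _
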